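/- arXiv:2410.04502 — 3 statements merged into one kernel-verified Lean document; each statement's English description precedes it below -/
import Mathlib

section
/- In U = U_q(A(0,2)^{(4)})^+ one has [L₂, L₁²] = 0 and [L₃, L₁²] = 0, i.e. L₂ commutes with L₁² and L₃ commutes with L₁² (the braided brackets here have braiding scalar 1, so they are plain commutators). -/
noncomputable section

namespace QAff

abbrev F : Type := FreeAlgebra ℂ (Fin 2)

def x1 : F := FreeAlgebra.ι ℂ 0
def x2 : F := FreeAlgebra.ι ℂ 1

def θ (q : ℂ) : ℂ := q - q⁻¹

def L1F (q : ℂ) : F := x1 * x2 - q⁻¹ • (x2 * x1)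

def X2F (q : ℂ) : F := x1 * L1F q - L1F q * x1

def Y2F (q : ℂ) : F := L1F q * x2 + x2 * L1F q

/-- the quantum Serre relator `[x₁,[x₁,[x₁,x₂]]]` (braided brackets w.r.t. the bicharacter
`χ((a,b),(c,d)) = (-1)^(bd) q^(ac-ad-bc+bd)`). -/
def serre1 (q : ℂ) : F := x1 * X2F q - q • (X2F q * x1)

/-- the quantum Serre relator `[[[x₁,x₂],x₂],x₂]` (braided brackets). -/
def serre2 (q : ℂ) : F := Y2F q * x2 - q • (x2 * Y2F q)

inductive Rel (q : ℂ) : F → F → Prop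
  | one : Rel q (serre1 q) 0
  | two : Rel q (serre2 q) 0

/-- `U = U_q(A(0,2)^{(4)})^+`, the free algebra on `x₁, x₂` modulo the two-sided ideal
generated by the quantum Serre relators. -/
abbrev U (q : ℂ) : Type := RingQuot (Rel q)

def π (q : ℂ) : F →ₐ[ℂ] U q := RingQuot.mkAlgHom ℂ (Rel q)

/-- `L₁ = [X₁,Y₁] = x₁x₂ - q⁻¹ x₂x₁` in `U`. -/
def L1U (q : ℂ) : U q := π q x1 * π q x2 - q⁻¹ • (π q x2 * π q x1)

/-- real root vectors `X_n`, `n ≥ 1` (`X 0 := 0` is junk):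
`X₁ = x₁`, `X_{n+1} = [X_n, L₁] = X_n L₁ - (-1)^(n-1) L₁ X_n`
(the braiding scalar is `χ((n,n-1),(1,1)) = (-1)^(n-1)`). -/
def X (q : ℂ) : ℕ → U q
  | 0 => 0
  | 1 => π q x1
  | (n+2) => X q (n+1) * L1U q - ((-1 : ℂ)^n) • (L1U q * X q (n+1))

/-- real root vectors `Y_n`, `n ≥ 1` (`Y 0 := 0` is junk):
`Y₁ = x₂`, `Y_{n+1} = [L₁, Y_n] = L₁ Y_n - (-1)^n Y_n L₁`
(the braiding scalar is `χ((1,1),(n-1,n)) = (-1)^n`). -/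
def Y (q : ℂ) : ℕ → U q
  | 0 => 0
  | 1 => π q x2
  | (n+2) => L1U q * Y q (n+1) - ((-1 : ℂ)^(n+1)) • (Y q (n+1) * L1U q)

/-- `L₀ = θ⁻¹·1`, and `L_n = [X₁, Y_n] = X₁Y_n - q⁻¹ Y_n X₁` for `n ≥ 1`
(the braiding scalar is `χ((1,0),(n-1,n)) = q⁻¹`). -/
def L (q : ℂ) : ℕ → U q
  | 0 => (θ q)⁻¹ • 1
  | (n+1) => X q 1 * Y q (n+1) - q⁻¹ • (Y q (n+1) * X q 1)

/-- `L₀′ = θ⁻¹·1`, `L₁′ = L₁`, and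
`L_n′ = [X₂, Y_{n-1}] = X₂Y_{n-1} - (-1)^(n-1) q⁻¹ Y_{n-1}X₂` for `n ≥ 2`
(the braiding scalar is `χ((2,1),(n-2,n-1)) = (-1)^(n-1) q⁻¹`). -/
def L' (q : ℂ) : ℕ → U q
  | 0 => (θ q)⁻¹ • 1
  | 1 => L q 1
  | (n+2) => X q 2 * Y q (n+1) - ((-1 : ℂ)^(n+1) * q⁻¹) • (Y q (n+1) * X q 2)

/-- `M q n` is the element `M_{2n+1}`:  `M₁ = L₁`, `M_{2n+1} = [L₂, M_{2n-1}]`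
(a plain commutator, the braiding scalar being `1`). -/
def M (q : ℂ) : ℕ → U q
  | 0 => L q 1
  | (n+1) => L q 2 * M q n - M q n * L q 2

/-- `L̃_n = (L_n + L_n′)/2`, with the convention `L̃_n = 0` for `n < 0`
(note `L̃₀ = θ⁻¹·1`). -/
def Lt (q : ℂ) (n : ℤ) : U q :=
  if 0 ≤ n then ((2 : ℂ)⁻¹) • (L q n.toNat + L' q n.toNat) else 0

/-- `L̂_{n+1} = [L_n, L₁] = L_n L₁ - (-1)^n L₁ L_n`
(the braiding scalar is `χ((n,n),(1,1)) = (-1)^n`); in particular `L̂₁ = 0`. -/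
def Lhat (q : ℂ) : ℕ → U q
  | 0 => 0
  | (n+1) => L q n * L q 1 - ((-1 : ℂ)^n) • (L q 1 * L q n)

/-- the sequence `P₀ = 1`, `P_n = q^n + q^(n-1) + (-1)^(n-1) P_(n-1)`. -/
def P (q : ℂ) : ℕ → ℂ
  | 0 => 1
  | (n+1) => q^(n+1) + q^n + (-1 : ℂ)^n * P q n

/-- the sequence `Q₀ = 1`, `Q_n = q^n - q^(n-1) + (-1)^n Q_(n-1)`. -/
def Q (q : ℂ) : ℕ → ℂ
  | 0 => 1
  | (n+1) => q^(n+1) - q^n + (-1 : ℂ)^(n+1) * Q q n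

/-- `q` is not a root of unity. -/
def NotRootOfUnity (q : ℂ) : Prop := ∀ n : ℕ, n ≠ 0 → q ^ n ≠ 1

end QAff

namespace QAff

section Relations

variable {A : Type*} [Ring A] [Algebra ℂ A] {q : ℂ} {a b l x y p : A}

/-- `[X₁, L₂′] = q X₂ L₁ + q⁻¹ L₁ X₂`. -/
lemma commutator_left_root (hq0 : q ≠ 0) (hl : a * b - q⁻¹ • (b * a) = l)
    (hax : a * x = q • (x * a)) (hp : x * b + q⁻¹ • (b * x) = p) :
    a * p - p * a = q • (x * l) + q⁻¹ • (l * x) := by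
  subst hp
  linear_combination (norm := skip) hax * b + q • (x * hl) + q⁻¹ • (hl * x) +
    (q⁻¹ * q⁻¹) • (b * hax)
  simp only [mul_add, add_mul, mul_sub, sub_mul, smul_mul_assoc, mul_smul_comm, mul_assoc,
    smul_sub, smul_smul]
  match_scalars <;> field_simp <;> ring

/-- `[L₂, Y₁] = q L₁ Y₂ - q⁻¹ Y₂ L₁`. -/
lemma commutator_right_root (hq0 : q ≠ 0) (hl : a * b - q⁻¹ • (b * a) = l)
    (hyb : y * b = q • (b * y)) (hp : a * y - q⁻¹ • (y * a) = p) :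
    p * b - b * p = q • (l * y) - q⁻¹ • (y * l) := by
  subst hp
  linear_combination (norm := skip) a * hyb - q⁻¹ • (y * hl) + q • (hl * y) -
    (q⁻¹ * q⁻¹) • (hyb * a)
  simp only [mul_sub, sub_mul, smul_mul_assoc, mul_smul_comm, mul_assoc,
    smul_sub, smul_smul]
  match_scalars <;> field_simp <;> ring

/-- `L₂ = L₂′ + 2 L₁²`. -/
lemma imaginary_root_eq (hl : a * b - q⁻¹ • (b * a) = l) (hx : a * l - l * a = x)
    (hy : l * b + b * l = y) (hp : x * b + q⁻¹ • (b * x) = p) :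
    a * y - q⁻¹ • (y * a) = p + (2 : ℂ) • (l * l) := by
  subst hx hy hp
  linear_combination (norm := skip) hl * l + l * hl
  simp only [mul_add, add_mul, mul_sub, sub_mul, smul_mul_assoc, mul_smul_comm, mul_assoc,
    smul_add, smul_sub]
  match_scalars <;> ring

/-- The bracket `[X₂, Y₂]` expressed through `L₂′` and `L₁`. -/
lemma bracket_real_roots (hq0 : q ≠ 0) (hl : a * b - q⁻¹ • (b * a) = l)
    (hx : a * l - l * a = x) (hy : l * b + b * l = y)
    (hp : x * b + q⁻¹ • (b * x) = p)
    (hr : a * y - q⁻¹ • (y * a) = p + (2 : ℂ) • (l * l))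
    (hap : a * p - p * a = q • (x * l) + q⁻¹ • (l * x))
    (hpb : p * b - b * p = (q - 2) • (l * y) + (2 - q⁻¹) • (y * l)) :
    (2 : ℂ) • (x * y - q⁻¹ • (y * x)) =
      (1 + q - q⁻¹) • (p * l) + (q - 1 - q⁻¹) • (l * p) +
        (2 * (q - q⁻¹)) • (l * (l * l)) := by
  linear_combination (norm := skip) a * hpb - hap * b - q⁻¹ • (hpb * a) + q⁻¹ • (b * hap) -
    p * hl + hl * p - q • (x * hy) + (q - 2) • (hx * y) + (q⁻¹ * (2 - q⁻¹)) • (y * hx) +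
    (q⁻¹ * q⁻¹) • (hy * x) + q • (hp * l) - q⁻¹ • (l * hp) + (q - 2) • (l * hr) +
    (2 - q⁻¹) • (hr * l)
  simp only [mul_add, add_mul, mul_sub, sub_mul, smul_mul_assoc, mul_smul_comm, mul_assoc,
    smul_add, smul_sub, smul_smul]
  match_scalars <;> field_simp <;> ring

/-- The commutator `[X₂, L₂′]` expressed through `X₂` and `L₁`. -/
lemma commutator_second_real_root (hq0 : q ≠ 0) (hx : a * l - l * a = x)
    (hax : a * x = q • (x * a))
    (hr : a * y - q⁻¹ • (y * a) = p + (2 : ℂ) • (l * l))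
    (hap : a * p - p * a = q • (x * l) + q⁻¹ • (l * x))
    (hz : (2 : ℂ) • (x * y - q⁻¹ • (y * x)) =
      (1 + q - q⁻¹) • (p * l) + (q - 1 - q⁻¹) • (l * p) +
        (2 * (q - q⁻¹)) • (l * (l * l))) :
    (q + q⁻¹ + 1) • (x * p - p * x) =
      (q ^ 2 - q - 1 - 2 * q⁻¹) • (x * (l * l)) +
      (2 * q + 1 + q⁻¹ - q⁻¹ ^ 2) • (l * (l * x)) +
      (q ^ 2 + q - q⁻¹ - q⁻¹ ^ 2) • (l * (x * l)) := by
  linear_combination (norm := skip) a * hz - hz * a -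
    (2 : ℂ) • (hax * y + q • (x * hr) - q⁻¹ • (hr * x) - (q⁻¹ * q⁻¹) • (y * hax)) +
    (1 + q - q⁻¹) • (hap * l + p * hx) + (q - 1 - q⁻¹) • (hx * p + l * hap) +
    (2 * (q - q⁻¹)) • (hx * (l * l) + l * (hx * l) + l * (l * hx))
  simp only [mul_add, add_mul, mul_sub, sub_mul, smul_mul_assoc, mul_smul_comm, mul_assoc,
    smul_add, smul_sub, smul_smul]
  match_scalars <;> field_simp <;> ring

/-- Once `[X₂, L₂′]` and `[X₂, Y₂]` are known, `L₂′` commutes with `L₁²` up to a scalar. -/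
lemma smul_commutator_sq (hq0 : q ≠ 0) (hy : l * b + b * l = y)
    (hp : x * b + q⁻¹ • (b * x) = p)
    (hpb : p * b - b * p = (q - 2) • (l * y) + (2 - q⁻¹) • (y * l))
    (hz : (2 : ℂ) • (x * y - q⁻¹ • (y * x)) =
      (1 + q - q⁻¹) • (p * l) + (q - 1 - q⁻¹) • (l * p) +
        (2 * (q - q⁻¹)) • (l * (l * l)))
    (hxp : (q + q⁻¹ + 1) • (x * p - p * x) =
      (q ^ 2 - q - 1 - 2 * q⁻¹) • (x * (l * l)) +
      (2 * q + 1 + q⁻¹ - q⁻¹ ^ 2) • (l * (l * x)) +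
      (q ^ 2 + q - q⁻¹ - q⁻¹ ^ 2) • (l * (x * l))) :
    ((q + q⁻¹) * (q + q⁻¹ - 1) * (q + q⁻¹ + 1)) • (p * (l * l) - l * (l * p)) = 0 := by
  have hxpb : (q ^ 2 + q - q⁻¹ - q⁻¹ ^ 2) •
      ((x * y - q⁻¹ • (y * x)) * l - l * (x * y - q⁻¹ • (y * x))) =
      (q ^ 2 - q - 1 - 2 * q⁻¹) • (p * (l * l)) +
      (2 * q + 1 + q⁻¹ - q⁻¹ ^ 2) • (l * (l * p)) -
      (q ^ 2 + q - q⁻¹ - q⁻¹ ^ 2) • (l * (p * l)) := by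
    linear_combination (norm := skip) hxp * b + q⁻¹ • (b * hxp) -
      (q + q⁻¹ + 1) • (x * hpb + hp * p - p * hp + q⁻¹ • (hpb * x)) +
      (q ^ 2 - q - 1 - 2 * q⁻¹) • (x * (l * hy - hy * l) + hp * (l * l)) +
      (2 * q + 1 + q⁻¹ - q⁻¹ ^ 2) • (l * (l * hp) - q⁻¹ • ((l * hy - hy * l) * x)) +
      (q ^ 2 + q - q⁻¹ - q⁻¹ ^ 2) • (l * (x * hy) + q⁻¹ • (hy * (x * l)) - l * (hp * l))
    simp only [mul_add, add_mul, mul_sub, sub_mul, smul_mul_assoc, mul_smul_comm, mul_assoc,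
      smul_add, smul_sub, smul_smul]
    match_scalars <;> field_simp <;> ring
  linear_combination (norm := skip) (2 : ℂ) • hxpb -
    (q ^ 2 + q - q⁻¹ - q⁻¹ ^ 2) • (hz * l - l * hz)
  simp only [mul_add, add_mul, mul_sub, sub_mul, smul_mul_assoc, mul_smul_comm, mul_assoc,
    smul_add, smul_sub, smul_smul]
  match_scalars <;> field_simp <;> ring

lemma NotRootOfUnity.add_inv_mul_ne_zero (hq0 : q ≠ 0) (hq : NotRootOfUnity q) :
    (q + q⁻¹) * (q + q⁻¹ - 1) * (q + q⁻¹ + 1) ≠ 0 := by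
  have hinv : q * q⁻¹ = 1 := mul_inv_cancel₀ hq0
  refine mul_ne_zero (mul_ne_zero ?_ ?_) ?_ <;> intro h
  · refine hq 4 (by norm_num) ?_
    linear_combination (q ^ 2 - 1) * (q * h - hinv)
  · refine hq 6 (by norm_num) ?_
    linear_combination (q ^ 3 - 1) * (q + 1) * (q * h - hinv)
  · refine hq 3 (by norm_num) ?_
    linear_combination (q - 1) * (q * h - hinv)

/-- Both assertions in an arbitrary algebra with generators satisfying the Serre relations. -/
lemma commute_sq_of_serre (hq0 : q ≠ 0) (hq : NotRootOfUnity q)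
    (hl : a * b - q⁻¹ • (b * a) = l) (hx : a * l - l * a = x) (hy : l * b + b * l = y)
    (hax : a * x = q • (x * a)) (hyb : y * b = q • (b * y)) :
    Commute (a * y - q⁻¹ • (y * a)) (l ^ 2) ∧
    Commute (a * (l * y - y * l) - q⁻¹ • ((l * y - y * l) * a)) (l ^ 2) := by
  obtain ⟨p, hp⟩ : ∃ p, x * b + q⁻¹ • (b * x) = p := ⟨_, rfl⟩
  have hr := imaginary_root_eq hl hx hy hp
  have hap := commutator_left_root hq0 hl hax hp
  have hpb : p * b - b * p = (q - 2) • (l * y) + (2 - q⁻¹) • (y * l) := by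
    linear_combination (norm := skip) commutator_right_root hq0 hl hyb hr -
      (2 : ℂ) • (l * hy - hy * l)
    simp only [mul_add, add_mul, smul_mul_assoc, mul_smul_comm, mul_assoc, smul_add]
    match_scalars <;> ring
  have hz := bracket_real_roots hq0 hl hx hy hp hr hap hpb
  have hxp := commutator_second_real_root hq0 hx hax hr hap hz
  have hpl : Commute p (l ^ 2) := by
    have h := (smul_eq_zero.mp (smul_commutator_sq hq0 hy hp hpb hz hxp)).resolve_left
      (hq.add_inv_mul_ne_zero hq0)
    rw [commute_iff_eq, sq, mul_assoc l l p]
    exact sub_eq_zero.mp h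
  have hll : Commute l (l ^ 2) := Commute.self_pow l 2
  have hL3 : a * (l * y - y * l) - q⁻¹ • ((l * y - y * l) * a) =
      (2⁻¹ * (q - q⁻¹ - 1)) • (p * l) + (2⁻¹ * (q - q⁻¹ + 1)) • (l * p) +
        (q - q⁻¹) • (l * (l * l)) := by
    linear_combination (norm := skip) hx * y - q⁻¹ • (y * hx) + l * hr - hr * l +
      (2⁻¹ : ℂ) • hz
    simp only [mul_add, add_mul, mul_sub, sub_mul, smul_mul_assoc, mul_smul_comm, mul_assoc,
      smul_add, smul_sub, smul_smul]
    match_scalars <;> ring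
  constructor
  · rw [hr]
    exact hpl.add_left ((hll.mul_left hll).smul_left _)
  · rw [hL3]
    exact (((hpl.mul_left hll).smul_left _).add_left ((hll.mul_left hpl).smul_left _)).add_left
      ((hll.mul_left (hll.mul_left hll)).smul_left _)

end Relations

lemma serre_left (q : ℂ) : X q 1 * X q 2 = q • (X q 2 * X q 1) := by
  have h := RingQuot.mkAlgHom_rel ℂ (Rel.one (q := q))
  rw [map_zero] at h
  refine sub_eq_zero.mp (Eq.trans ?_ h)
  simp [serre1, X2F, L1F, X, L1U, π]

lemma sub_neg_one_smul {A : Type*} [Ring A] [Algebra ℂ A] (u v : A) :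
    u - (-1 : ℂ) • v = u + v := by
  simp

lemma Y_two (q : ℂ) : Y q 2 = L1U q * Y q 1 + Y q 1 * L1U q := by
  change L1U q * Y q 1 - ((-1 : ℂ) ^ 1) • (Y q 1 * L1U q) = _
  rw [pow_one]
  exact sub_neg_one_smul _ _

lemma serre_right (q : ℂ) : Y q 2 * Y q 1 = q • (Y q 1 * Y q 2) := by
  have h := RingQuot.mkAlgHom_rel ℂ (Rel.two (q := q))
  rw [map_zero] at h
  refine sub_eq_zero.mp (Eq.trans ?_ h)
  rw [Y_two]
  simp [serre2, Y2F, L1F, Y, L1U, π]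

end QAff

open QAff

/-- In `U = U_q(A(0,2)^{(4)})^+`: `[L₂, L₁²] = 0` and `[L₃, L₁²] = 0`
(plain commutators, since the braiding scalars equal `1`). -/
theorem stmt7 (q : ℂ) (hq0 : q ≠ 0) (hq : NotRootOfUnity q) :
    L q 2 * (L q 1)^2 - (L q 1)^2 * L q 2 = 0 ∧
    L q 3 * (L q 1)^2 - (L q 1)^2 * L q 3 = 0 := by
  have hX2 : X q 1 * L q 1 - L q 1 * X q 1 = X q 2 := by simp [X, Y, L, L1U]
  have hY2 : L q 1 * Y q 1 + Y q 1 * L q 1 = Y q 2 := (Y_two q).symm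
  have hY3 : L q 1 * Y q 2 - Y q 2 * L q 1 = Y q 3 := by simp [X, Y, L, L1U]
  obtain ⟨h2, h3⟩ :=
    commute_sq_of_serre hq0 hq (l := L q 1) rfl hX2 hY2 (serre_left q) (serre_right q)
  rw [hY3] at h3
  exact ⟨sub_eq_zero.mpr h2.eq, sub_eq_zero.mpr h3.eq⟩
end
end

section
/- In U = U_q(A(0,2)^{(4)})^+, for every n ≥ 0: L̃_{2n+1} = (θ/2)·L₁L̃_{2n} + (θ/2)·L̃_{2n}L₁ + (1/4)·[L̃_{2n−2}, M₃], where [L̃_{2n−2}, M₃] = L̃_{2n−2}M₃ − M₃L̃_{2n−2} is a plain commutator and the conventions L̃₀ = θ⁻¹·1, L̃_{−2} = 0 are used. -/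
noncomputable section

open QAff

theorem sub_inv_ne_zero_of_sq_ne_one {K : Type*} [Field K] {q : K} (hq0 : q ≠ 0) (hq : q ^ 2 ≠ 1) :
    q - q⁻¹ ≠ 0 := by
  rwa [Ne, sub_eq_zero, ← mul_eq_one_iff_eq_inv₀ hq0, ← sq]

/-- `M i * M (i + 1) + M (i + 1) * M i`, the commutator of `T` with `M i * M i`. -/
def consecutive {A : Type*} [Ring A] (M : ℕ → A) (i : ℕ) : A := M i * M (i + 1) + M (i + 1) * M i

theorem lie_mul_self_eq_consecutive {A : Type*} [Ring A] {M : ℕ → A} {T : A}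
    (hM : ∀ j, M (j + 1) = T * M j - M j * T) (i : ℕ) :
    ⁅T, M i * M i⁆ = consecutive M i := by
  rw [Ring.lie_def, consecutive, hM i]
  noncomm_ring

section Exchange

variable {A : Type*} [Ring A] [Algebra ℂ A]

/-- The exchange relation between `M i` and the sequence `t`, in degree `m`. With `M (i + 1)` the
commutator of `T` with `M i`, this is stable under commutation with `T`. -/
def Exchange (θ : ℂ) (t : ℤ → A) (M : ℕ → A) (m : ℤ) (i : ℕ) : Prop :=
  t m * M i - (θ / 2) • (t (m - 1) * M (i + 1)) - (4 : ℂ)⁻¹ • (t (m - 2) * M (i + 2))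
    = M i * t m + (θ / 2) • (M (i + 1) * t (m - 1)) - (4 : ℂ)⁻¹ • (M (i + 2) * t (m - 2))

theorem Exchange.succ {θ : ℂ} {t : ℤ → A} {M : ℕ → A} {m : ℤ} {i : ℕ} {T : A}
    (h : Exchange θ t M m i) (hM : ∀ j, M (j + 1) = T * M j - M j * T)
    (h0 : Commute T (t m)) (h1 : Commute T (t (m - 1))) (h2 : Commute T (t (m - 2))) :
    Exchange θ t M m (i + 1) := by
  unfold Exchange at *
  have e0 := h0.eq
  have e1 := h1.eq
  have e2 := h2.eq
  have m1 := hM i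
  have m2 := hM (i + 1)
  have m3 := hM (i + 1 + 1)
  rw [show i + 1 + 2 = i + 1 + 1 + 1 from rfl, m3, m2]
  rw [show i + 2 = i + 1 + 1 from rfl] at h
  rw [m2] at h
  generalize M (i + 1) = N at *
  generalize M i = N0 at *
  generalize t m = t0 at *
  generalize t (m - 1) = t1 at *
  generalize t (m - 2) = t2 at *
  subst m1
  linear_combination (norm := skip) T * h - h * T - e0 * N0 + (θ / 2) • (e1 * (T * N0 - N0 * T))
    + (4 : ℂ)⁻¹ • (e2 * (T * (T * N0 - N0 * T) - (T * N0 - N0 * T) * T))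
    + N0 * e0 + (θ / 2) • ((T * N0 - N0 * T) * e1)
    - (4 : ℂ)⁻¹ • ((T * (T * N0 - N0 * T) - (T * N0 - N0 * T) * T) * e2)
  simp only [mul_add, add_mul, mul_sub, sub_mul, smul_mul_assoc, mul_smul_comm, mul_assoc]
  module

theorem Exchange.lie_sq {θ : ℂ} {t : ℤ → A} {M : ℕ → A} {m : ℤ} {i : ℕ} {T : A}
    (h0 : Exchange θ t M m i) (h1 : Exchange θ t M (m - 1) i) (h2 : Exchange θ t M (m - 2) i)
    (hM : ∀ j, M (j + 1) = T * M j - M j * T)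
    (hK : M i * M (i + 1) + M (i + 1) * M i = 0) :
    ⁅t m, M i * M i⁆ + ((θ ^ 2 + 2) / 4) • ⁅t (m - 2), M (i + 1) * M (i + 1)⁆
        + (16 : ℂ)⁻¹ • ⁅t (m - 4), M (i + 2) * M (i + 2)⁆
      = -(θ / 8) • ((M (i + 1) * M (i + 2) + M (i + 2) * M (i + 1)) * t (m - 3)
          + t (m - 3) * (M (i + 1) * M (i + 2) + M (i + 2) * M (i + 1))) := by
  have hK2 : M i * M (i + 2) + M (i + 2) * M i + (2 : ℂ) • (M (i + 1) * M (i + 1)) = 0 := by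
    rw [show i + 2 = i + 1 + 1 from rfl, hM (i + 1)]
    have e := hM i
    generalize M (i + 1) = N at *
    generalize M i = N0 at *
    linear_combination (norm := skip) T * hK - hK * T + N * e + e * N
    simp only [mul_add, add_mul, mul_sub, sub_mul, mul_assoc,
      mul_zero, zero_mul]
    module
  unfold Exchange at *
  rw [show m - 1 - 1 = m - 2 by ring, show m - 1 - 2 = m - 3 by ring] at h1
  rw [show m - 2 - 1 = m - 3 by ring, show m - 2 - 2 = m - 4 by ring] at h2
  clear hM
  simp only [Ring.lie_def]
  generalize M (i + 1) = N1 at *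
  generalize M (i + 2) = N2 at *
  generalize M i = N0 at *
  generalize t m = t0 at *
  generalize t (m - 1) = t1 at *
  generalize t (m - 2) = t2 at *
  generalize t (m - 3) = t3 at *
  generalize t (m - 4) = t4 at *
  linear_combination (norm := skip) h0 * N0 - (θ / 2) • (h1 * N1) - (4 : ℂ)⁻¹ • (h2 * N2)
    + N0 * h0 + (θ / 2) • (N1 * h1) - (4 : ℂ)⁻¹ • (N2 * h2)
    + (θ / 2) • (t1 * hK) + (θ / 2) • (hK * t1)
    + (4 : ℂ)⁻¹ • (t2 * hK2) - (4 : ℂ)⁻¹ • (hK2 * t2)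
  simp only [mul_add, add_mul, mul_sub, sub_mul, smul_mul_assoc, mul_smul_comm, mul_assoc,
    mul_zero, zero_mul]
  module

theorem Exchange.of_zero {θ : ℂ} {t : ℤ → A} {M : ℕ → A} {T : A} {n m : ℤ} {i : ℕ}
    (hM : ∀ j, M (j + 1) = T * M j - M j * T) (hT : ∀ m < n, Commute T (t m))
    (hE : ∀ m ≤ n, Exchange θ t M m 0) (hm : m ≤ n) (hi : i = 0 ∨ m < n) :
    Exchange θ t M m i := by
  induction i with
  | zero => exact hE m hm
  | succ i ih =>
    have hmn : m < n := by simpa using hi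
    exact (ih (Or.inr hmn)).succ hM (hT _ hmn) (hT _ (by lia)) (hT _ (by lia))

theorem lie_odd_mul_self {q : ℂ} (hq0 : q ≠ 0) (hθ : q - q⁻¹ ≠ 0) {t : ℤ → A} {M : ℕ → A}
    {T : A} {n : ℤ}
    (hM : ∀ j, M (j + 1) = T * M j - M j * T) (hT : ∀ m < n, Commute T (t m))
    (hE : ∀ m ≤ n, Exchange (q - q⁻¹) t M m 0) (hneg : ∀ m < 0, t m = 0)
    (ht0 : t 0 = (q - q⁻¹)⁻¹ • 1) (ht1 : t 1 = T) {j : ℕ} (hj : (2 * j + 1 : ℤ) ≤ n)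
    (hK : ∀ i < j, consecutive M i = 0) (r : ℕ) :
    ∀ i, i + r = j → (q - q⁻¹) • ⁅t (2 * r + 1), M i * M i⁆
      = ((-4⁻¹) ^ r * (q ^ (2 * r + 1) - q⁻¹ ^ (2 * r + 1))) • consecutive M j := by
  induction r using Nat.strong_induction_on with
  | _ r ih =>
  intro i hi
  match r, ih with
  | 0, _ =>
    obtain rfl : i = j := by lia
    simp [ht1, lie_mul_self_eq_consecutive hM]
  | 1, ih =>
    have h0 := ih 0 (by lia) (i + 1) (by lia)
    have hx := fun m (hm : m ≤ 3) => Exchange.of_zero (m := m) (i := i) hM hT hE (by lia) (by lia)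
    have h := (hx 3 le_rfl).lie_sq (hx _ (by lia)) (hx _ (by lia)) hM (hK i (by lia))
    obtain rfl : i + 1 = j := hi
    have hc (x : A) : -((q - q⁻¹) / 8) • ((q - q⁻¹)⁻¹ • x + (q - q⁻¹)⁻¹ • x) = -(4 : ℂ)⁻¹ • x := by
      rw [← add_smul, smul_smul]
      congr 1
      grind
    norm_num only [hneg, ht0, Ring.lie_def, mul_smul_comm, smul_mul_assoc, mul_one, one_mul, hc,
      zero_mul, mul_zero, smul_zero, sub_zero, add_zero, pow_zero, one_smul, pow_one] at h h0 ⊢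
    simp only [consecutive, add_assoc, Nat.reduceAdd] at h0 h ⊢
    linear_combination (norm := skip) (q - q⁻¹) • h - (((q - q⁻¹) ^ 2 + 2) / 4) • h0
    match_scalars <;> (try simp only [inv_pow]) <;> field_simp <;> ring
  | r + 2, ih =>
    have h0 := ih r (by lia) (i + 2) (by lia)
    have h1 := ih (r + 1) (by lia) (i + 1) (by lia)
    have hx := fun m (hm : m ≤ (2 * r + 5 : ℤ)) =>
      Exchange.of_zero (m := m) (i := i) hM hT hE (by lia) (by lia)
    have h := (hx _ le_rfl).lie_sq (hx _ (by lia)) (hx _ (by lia)) hM (hK i (by lia))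
    have hK1 : M (i + 1) * M (i + 2) + M (i + 2) * M (i + 1) = 0 := hK (i + 1) (by lia)
    rw [hK1] at h
    rw [show (2 * r + 5 - 2 : ℤ) = 2 * (r + 1 : ℕ) + 1 by push_cast; ring,
      show (2 * r + 5 - 4 : ℤ) = 2 * r + 1 by ring,
      show (2 * r + 5 : ℤ) = 2 * (r + 2 : ℕ) + 1 by push_cast; ring] at h
    simp only [zero_mul, mul_zero, add_zero, smul_zero] at h
    linear_combination (norm := skip) (q - q⁻¹) • h - (((q - q⁻¹) ^ 2 + 2) / 4) • h1
      - (16 : ℂ)⁻¹ • h0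
    match_scalars <;> (try simp only [inv_pow]) <;> field_simp <;> ring

theorem consecutive_eq_zero {q : ℂ} (hq0 : q ≠ 0) (hq : ∀ n : ℕ, n ≠ 0 → q ^ n ≠ 1)
    {t : ℤ → A} {M : ℕ → A} {T : A} {n : ℤ}
    (hM : ∀ j, M (j + 1) = T * M j - M j * T) (hT : ∀ m < n, Commute T (t m))
    (hE : ∀ m ≤ n, Exchange (q - q⁻¹) t M m 0) (hneg : ∀ m < 0, t m = 0)
    (ht0 : t 0 = (q - q⁻¹)⁻¹ • 1) (ht1 : t 1 = T)
    (hS : ∀ m, 2 ≤ m → m ≤ n → (3 + (q - q⁻¹) ^ 2) • ⁅t m, M 0 * M 0⁆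
      = -(4 : ℂ)⁻¹ • ⁅t (m - 2), M 1 * M 1⁆)
    (hK : consecutive M 0 = 0) (j : ℕ) (hj : (2 * j + 1 : ℤ) ≤ n) :
    consecutive M j = 0 := by
  induction j using Nat.strong_induction_on with
  | _ j ih =>
  match j, ih with
  | 0, _ => exact hK
  | j + 1, ih =>
    have hθ := sub_inv_ne_zero_of_sq_ne_one hq0 (hq 2 two_ne_zero)
    have key := lie_odd_mul_self hq0 hθ hM hT hE hneg ht0 ht1 hj (fun i hi => ih i hi (by lia))
    have h1 := key (j + 1) 0 (by lia)
    have h0 := key j 1 (by lia)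
    have h := hS (2 * (j + 1 : ℕ) + 1) (by lia) hj
    rw [show (2 * (j + 1 : ℕ) + 1 - 2 : ℤ) = 2 * j + 1 by push_cast; ring] at h
    have e : ((-4⁻¹) ^ (j + 1) * ((q ^ 2 + 1) * (q ^ (4 * j + 8) - 1) / q ^ (2 * j + 5)))
        • consecutive M (j + 1) = 0 := by
      linear_combination (norm := skip) (q - q⁻¹) • h - (3 + (q - q⁻¹) ^ 2) • h1 - (4:ℂ)⁻¹ • h0
      match_scalars <;> (try simp only [inv_pow]) <;> field_simp <;> ring
    refine (smul_eq_zero.mp e).resolve_left ?_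
    have h2 : q ^ 2 + 1 ≠ 0 := fun h2 => hq 4 four_ne_zero (by linear_combination (q ^ 2 - 1) * h2)
    have h5 := sub_ne_zero.mpr (hq (4 * j + 8) (by lia))
    simp [h2, h5, hq0]

theorem lie_mul_self_eq_zero {q : ℂ} (hq0 : q ≠ 0) (hq : ∀ n : ℕ, n ≠ 0 → q ^ n ≠ 1)
    {t : ℤ → A} {M : ℕ → A} {T : A} {n : ℤ}
    (hM : ∀ j, M (j + 1) = T * M j - M j * T) (hT : ∀ m < n, Commute T (t m))
    (hE : ∀ m ≤ n, Exchange (q - q⁻¹) t M m 0) (hneg : ∀ m < 0, t m = 0)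
    (ht0 : t 0 = (q - q⁻¹)⁻¹ • 1) (ht1 : t 1 = T)
    (hS : ∀ m, 2 ≤ m → m ≤ n → (3 + (q - q⁻¹) ^ 2) • ⁅t m, M 0 * M 0⁆
      = -(4 : ℂ)⁻¹ • ⁅t (m - 2), M 1 * M 1⁆)
    (hK : consecutive M 0 = 0) (m i : ℕ) (hmi : (m + 2 * i : ℤ) ≤ n) :
    ⁅t m, M i * M i⁆ = 0 := by
  have hc := consecutive_eq_zero hq0 hq hM hT hE hneg ht0 ht1 hS hK
  induction m using Nat.strong_induction_on generalizing i with
  | _ m ih =>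
  rcases Nat.eq_zero_or_pos m with rfl | hm
  · simp [ht0, Ring.lie_def]
  have low (l : ℤ) (j : ℕ) (hl : l < m) (hj : l + 2 * j ≤ n) : ⁅t l, M j * M j⁆ = 0 := by
    rcases lt_or_ge l 0 with hl0 | hl0
    · simp [hneg l hl0, Ring.lie_def]
    · lift l to ℕ using hl0
      exact ih l (by lia) j hj
  have hx (l : ℤ) (hl : l ≤ m) := Exchange.of_zero (m := l) (i := i) hM hT hE (by lia) (by lia)
  have h := (hx _ le_rfl).lie_sq (hx _ (by lia)) (hx _ (by lia)) hM (hc i (by lia))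
  rw [low _ (i + 1) (by lia) (by lia), low _ (i + 2) (by lia) (by lia)] at h
  rcases le_or_gt 3 m with h3 | h3
  · have hK1 : M (i + 1) * M (i + 2) + M (i + 2) * M (i + 1) = 0 := hc (i + 1) (by lia)
    simpa [hK1] using h
  · simpa [hneg (m - 3) (by lia)] using h

end Exchange

section SquareRelation

variable {A : Type*} [Ring A] [Algebra ℂ A]

theorem square_relation {θ : ℂ} {l T U V W R S : A}
    (hW : W * l - l * W = T * S - S * T)
    (hR : (4 : ℂ) • R = (2 * θ) • (l * W + W * l) + (T * (U * l - l * U) - (U * l - l * U) * T))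
    (hS : T * (S * l + l * S) - (S * l + l * S) * T
      = (2 * θ) • (l * R - R * l) - (2 : ℂ) • (W * (l * l) - l * l * W))
    (hS' : (4 : ℂ) • S = (2 * θ) • (l * U + U * l) + (T * (V * l - l * V) - (V * l - l * V) * T))
    (hU : Commute T U) (hV : Commute T V) (hl : Commute T (l * l)) :
    (3 + θ ^ 2) • ⁅W, l * l⁆
      = -(4 : ℂ)⁻¹ • ⁅V, (T * l - l * T) * (T * l - l * T)⁆ := by
  have hU' := hU.eq
  have hV' := hV.eq
  have hl' : l * (T * l - l * T) + (T * l - l * T) * l = 0 := by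
    linear_combination (norm := noncomm_ring) hl.eq
  have hUM : T * (U * l - l * U) - (U * l - l * U) * T
      = U * (T * l - l * T) - (T * l - l * T) * U := by
    linear_combination (norm := noncomm_ring) hU' * l - l * hU'
  have hVM : T * (V * l - l * V) - (V * l - l * V) * T
      = V * (T * l - l * T) - (T * l - l * T) * V := by
    linear_combination (norm := noncomm_ring) hV' * l - l * hV'
  rw [hUM] at hR
  rw [hVM] at hS'
  have e1 : (T * S - S * T) * l + l * (T * S - S * T) = (T * (S * l + l * S) - (S * l + l * S) * T)
    - (S * (T * l - l * T) + (T * l - l * T) * S) := by noncomm_ring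
  rw [← hW] at e1
  clear hUM hVM hl hU hV hU' hV' hW
  simp only [Ring.lie_def]
  rw [hS] at e1
  generalize T * l - l * T = M at *
  clear hS
  linear_combination (norm := skip) e1 + (θ / 2) • (l * hR - hR * l)
    - (4 : ℂ)⁻¹ • (hS' * M + M * hS') - (θ / 2) • (U * hl' + hl' * U)
  simp only [mul_add, add_mul, mul_sub, sub_mul, smul_mul_assoc, mul_smul_comm, mul_assoc,
    mul_zero, zero_mul]
  module

theorem exchange_relation {θ : ℂ} {l T U V W S : A}
    (hW : W * l - l * W = T * S - S * T)
    (hS : (4 : ℂ) • S = (2 * θ) • (l * U + U * l) + (T * (V * l - l * V) - (V * l - l * V) * T))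
    (hU : Commute T U) (hV : Commute T V) :
    W * l - (θ / 2) • (U * (T * l - l * T))
        - (4 : ℂ)⁻¹ • (V * (T * (T * l - l * T) - (T * l - l * T) * T))
      = l * W + (θ / 2) • ((T * l - l * T) * U)
        - (4 : ℂ)⁻¹ • ((T * (T * l - l * T) - (T * l - l * T) * T) * V) := by
  have hU' := hU.eq
  have hV' := hV.eq
  linear_combination (norm := skip) hW + (4 : ℂ)⁻¹ • (T * hS - hS * T)
    + (θ / 2) • (hU' * l + l * hU')
    + (4 : ℂ)⁻¹ • (T * (hV' * l - l * hV') - (hV' * l - l * hV') * T)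
    + (4 : ℂ)⁻¹ • (hV' * (T * l - l * T) - (T * l - l * T) * hV')
  simp only [mul_add, add_mul, mul_sub, sub_mul, smul_mul_assoc, mul_smul_comm, mul_assoc]
  module

end SquareRelation

section LoopRelations

variable {A : Type*} [Ring A] [Algebra ℂ A]

/-- The relations between `T = L̃₂`, `l = L₁` and the sequences `a = (L_n)`, `b = (L_n′)` which
come from commuting `L̃₂` past `X₁`, `X₂` and the `Y_n`. -/
structure LoopRelations (q : ℂ) (l T : A) (a b : ℕ → A) : Prop where
  a_zero : a 0 = (q - q⁻¹)⁻¹ • 1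
  a_one : a 1 = l
  b_zero : b 0 = (q - q⁻¹)⁻¹ • 1
  b_succ : ∀ n, b (n + 1) = a (n + 1) + (-1 : ℂ) ^ n • (a n * l) - l * a n
  two : T = (2 : ℂ)⁻¹ • (a 2 + b 2)
  comm : Commute T (l * l)
  lie_a : ∀ n, T * a (n + 1) - a (n + 1) * T = (q - q⁻¹) • (l * (b (n + 2) + a (n + 2)))
    + (q - q⁻¹) • b (n + 3) - (q + 1) • (a (n + 1) * (l * l) - l * l * a (n + 1) + a (n + 3))
    + (q⁻¹ - (-1) ^ n) • a (n + 3)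
  lie_b : ∀ n, T * b (n + 1) - b (n + 1) * T
    = -(q - q⁻¹) • (l * (a n * (l * l) - l * l * a n + a (n + 2) + b (n + 2)))
    + (q - q⁻¹) • (a (n + 1) * (l * l) - l * l * a (n + 1) + a (n + 3))
    - (q - 1) • (b (n + 1) * (l * l) - l * l * b (n + 1) + b (n + 3))
    + (q⁻¹ + (-1) ^ n) • b (n + 3)

namespace LoopRelations

variable {q : ℂ} {l T : A} {a b : ℕ → A}

/-- The half sums of the two families. -/
noncomputable def mid (a b : ℕ → A) (n : ℕ) : A := (2 : ℂ)⁻¹ • (a n + b n)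

section

variable (h : LoopRelations q l T a b)
include h

theorem mid_zero : mid a b 0 = (q - q⁻¹)⁻¹ • 1 := by
  rw [mid, h.a_zero, h.b_zero]
  module

theorem mid_two : mid a b 2 = T := h.two.symm

theorem commute_a_zero : Commute (a 0) (l * l) := by
  rw [h.a_zero]
  exact (Commute.one_left _).smul_left _

theorem commute_a_one : Commute (a 1) (l * l) := by
  rw [h.a_one]
  exact (Commute.refl l).mul_right (Commute.refl l)

theorem commute_b {n : ℕ} (h0 : Commute (a n) (l * l)) (h1 : Commute (a (n + 1)) (l * l)) :
    Commute (b (n + 1)) (l * l) := by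
  have hl := (Commute.refl l).mul_right (Commute.refl l)
  rw [h.b_succ]
  exact (h1.add_left ((h0.mul_left hl).smul_left _)).sub_left (hl.mul_left h0)

theorem commute_a_of_mid {n : ℕ} (h0 : Commute (a n) (l * l))
    (h1 : Commute (mid a b (n + 1)) (l * l)) : Commute (a (n + 1)) (l * l) := by
  have hl := (Commute.refl l).mul_right (Commute.refl l)
  have e : a (n + 1) = mid a b (n + 1) - (2 : ℂ)⁻¹ • ((-1 : ℂ) ^ n • (a n * l) - l * a n) := by
    rw [mid, h.b_succ]
    module
  rw [e]
  exact h1.sub_left ((((h0.mul_left hl).smul_left _).sub_left (hl.mul_left h0)).smul_left _)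

theorem b_succ_of_even {n : ℕ} (hn : Even n) : b (n + 1) = a (n + 1) + a n * l - l * a n := by
  rw [h.b_succ, hn.neg_one_pow, one_smul]

theorem b_succ_of_odd {n : ℕ} (hn : Odd n) : b (n + 1) = a (n + 1) - a n * l - l * a n := by
  rw [h.b_succ, hn.neg_one_pow, neg_one_smul, sub_eq_add_neg (a (n + 1))]

theorem lie_mid_add_two {n : ℕ} (hn : Even n) (h0 : Commute (a n) (l * l))
    (h1 : Commute (a (n + 1)) (l * l)) :
    mid a b (n + 2) * l - l * mid a b (n + 2) = T * mid a b (n + 1) - mid a b (n + 1) * T := by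
  have ha := h.lie_a n
  have hb := h.lie_b n
  rw [sub_eq_zero.2 h0.eq, sub_eq_zero.2 h1.eq, sub_eq_zero.2 (h.commute_b h0 h1).eq] at hb
  rw [sub_eq_zero.2 h1.eq] at ha
  simp only [hn.neg_one_pow, h.b_succ_of_odd hn.add_one,
    h.b_succ_of_even (hn.add even_two)] at ha hb
  simp only [mid, h.b_succ_of_odd hn.add_one]
  simp only [add_assoc, Nat.reduceAdd] at ha hb ⊢
  linear_combination (norm := skip) -(2 : ℂ)⁻¹ • (ha + hb) - (2 : ℂ)⁻¹ • h1.eq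
  simp only [mul_add, add_mul, mul_sub, sub_mul, smul_mul_assoc, mul_smul_comm, mul_assoc,
    mul_zero]
  module

theorem lie_mid_of_even {n : ℕ} (hn : Even n) (hlow : ∀ j ≤ n, Commute (a j) (l * l)) :
    mid a b n * l - l * mid a b n = a n * l - l * a n := by
  rcases n with _ | n
  · simp [h.mid_zero, h.a_zero]
  · have hn' : Odd n := by simpa [Nat.even_add_one] using hn
    rw [mid, h.b_succ_of_odd hn']
    linear_combination (norm := skip) -(2 : ℂ)⁻¹ • (hlow n (by lia)).eq
    simp only [mul_add, add_mul, mul_sub, sub_mul, smul_mul_assoc, mul_smul_comm, mul_assoc]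
    module

theorem mid_add_three {n : ℕ} (hn : Even n) (hlow : ∀ j ≤ n + 1, Commute (a j) (l * l)) :
    (4 : ℂ) • mid a b (n + 3) = (2 * (q - q⁻¹)) • (l * mid a b (n + 2) + mid a b (n + 2) * l)
      + (T * (mid a b n * l - l * mid a b n) - (mid a b n * l - l * mid a b n) * T) := by
  have h0 := hlow n (by lia)
  have h1 := hlow (n + 1) le_rfl
  have ha := h.lie_a n
  have hb := h.lie_b n
  rw [h.lie_mid_of_even hn fun j hj => hlow j (by lia)]
  rw [sub_eq_zero.2 h0.eq, sub_eq_zero.2 h1.eq, sub_eq_zero.2 (h.commute_b h0 h1).eq] at hb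
  rw [sub_eq_zero.2 h1.eq] at ha
  simp only [hn.neg_one_pow, h.b_succ_of_odd hn.add_one, h.b_succ_of_even (hn.add even_two),
    h.b_succ_of_even hn] at ha hb
  simp only [mid, h.b_succ_of_odd hn.add_one, h.b_succ_of_even (hn.add even_two)]
  simp only [add_assoc, Nat.reduceAdd] at ha hb ⊢
  linear_combination (norm := skip) ha - hb + (q - q⁻¹) • h1.eq
  simp only [mul_add, add_mul, mul_sub, sub_mul, smul_mul_assoc, mul_smul_comm, mul_assoc,
    mul_zero]
  module

theorem commute_a_add_three {n : ℕ} (hn : Even n) (h1 : Commute (a (n + 1)) (l * l))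
    (h2 : Commute (a (n + 2)) (l * l)) : Commute (a (n + 3)) (l * l) := by
  have hl := (Commute.refl l).mul_right (Commute.refl l)
  have ha := h.lie_a n
  have h2' := h.commute_b h1 h2
  rw [sub_eq_zero.2 h1.eq, hn.neg_one_pow, h.b_succ_of_even (hn.add even_two)] at ha
  have e : a (n + 3) = (2 : ℂ)⁻¹ • ((q - q⁻¹) • (l * (b (n + 2) + a (n + 2)))
      + (q - q⁻¹) • (a (n + 2) * l - l * a (n + 2))
      - (T * a (n + 1) - a (n + 1) * T)) := by
    rw [ha]
    module
  rw [e]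
  have hlb := hl.mul_left (h2'.add_left h2)
  have hla := (h2.mul_left hl).sub_left (hl.mul_left h2)
  have hTa := (h.comm.mul_left h1).sub_left (h1.mul_left h.comm)
  exact (((hlb.smul_left _).add_left (hla.smul_left _)).sub_left hTa).smul_left _

theorem commute_two_mid {n : ℕ} (hn : Even n) (h1 : Commute (a (n + 1)) (l * l))
    (h2 : Commute (a (n + 2)) (l * l)) : Commute T (mid a b (n + 2)) := by
  have ha := h.lie_a (n + 1)
  have hb := h.lie_b (n + 1)
  rw [sub_eq_zero.2 h1.eq, sub_eq_zero.2 h2.eq, sub_eq_zero.2 (h.commute_b h1 h2).eq] at hb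
  rw [sub_eq_zero.2 h2.eq] at ha
  simp only [hn.add_one.neg_one_pow] at ha hb
  rw [commute_iff_eq, mid]
  simp only [add_assoc, Nat.reduceAdd] at ha hb ⊢
  linear_combination (norm := skip) (2 : ℂ)⁻¹ • (ha + hb)
  simp only [mul_add, add_mul, smul_mul_assoc, mul_smul_comm, mul_zero]
  module

theorem lie_two_mid {n : ℕ} (hn : Even n) (h0 : Commute (a n) (l * l))
    (h1 : Commute (a (n + 1)) (l * l)) :
    T * (mid a b (n + 1) * l + l * mid a b (n + 1))
        - (mid a b (n + 1) * l + l * mid a b (n + 1)) * T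
      = (2 * (q - q⁻¹)) • (l * mid a b (n + 3) - mid a b (n + 3) * l)
        - (2 : ℂ) • (mid a b (n + 2) * (l * l) - l * l * mid a b (n + 2)) := by
  have ha := h.lie_a (n + 1)
  have hb := h.lie_b (n + 1)
  have hd : b (n + 1 + 1) * (l * l) - l * l * b (n + 1 + 1)
      = a (n + 1 + 1) * (l * l) - l * l * a (n + 1 + 1) := by
    rw [h.b_succ_of_odd hn.add_one]
    linear_combination (norm := noncomm_ring) -(h1.eq * l) - l * h1.eq
  rw [sub_eq_zero.2 h1.eq, hd] at hb
  have e4 : b (n + 1 + 3) = _ := h.b_succ_of_odd (n := n + 3) (hn.add_odd (by decide))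
  simp only [hn.add_one.neg_one_pow, e4, show n + 1 + 2 = n + 2 + 1 from rfl,
    show n + 1 + 1 = n + 2 from rfl, h.b_succ_of_even (hn.add even_two)] at ha hb
  simp only [mid, h.b_succ_of_odd hn.add_one, h.b_succ_of_even (hn.add even_two),
    h.b_succ_of_even hn]
  rw [h.b_succ_of_odd hn.add_one] at hb
  simp only [add_assoc, Nat.reduceAdd] at ha hb ⊢
  linear_combination (norm := skip) ha - hb + (2 : ℂ)⁻¹ • (T * h0.eq - h0.eq * T)
    - h1.eq * l - l * h1.eq
  simp only [mul_add, add_mul, mul_sub, sub_mul, smul_mul_assoc, mul_smul_comm, mul_assoc,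
    mul_zero]
  module

end

/-- The even-indexed half sums, extended by zero to negative indices. -/
noncomputable def evenMid (a b : ℕ → A) (m : ℤ) : A :=
  if 0 ≤ m then mid a b (2 * m.toNat) else 0

theorem evenMid_natCast (m : ℕ) : evenMid a b m = mid a b (2 * m) := by
  simp [evenMid]

theorem evenMid_of_neg {m : ℤ} (hm : m < 0) : evenMid a b m = 0 := by
  simp [evenMid, hm]

/-- Iterated commutators of `l` with `T`. -/
def iteratedLie (T l : A) : ℕ → A
  | 0 => l
  | n + 1 => T * iteratedLie T l n - iteratedLie T l n * T

section

variable (h : LoopRelations q l T a b)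
include h

theorem commute_evenMid {n : ℕ} (hlow : ∀ j < 2 * n, Commute (a j) (l * l)) {m : ℤ} (hm : m < n) :
    Commute T (evenMid a b m) := by
  rcases lt_or_ge m 0 with hneg | hnn
  · simp [evenMid_of_neg hneg]
  lift m to ℕ using hnn
  rw [evenMid_natCast]
  rcases m with _ | m
  · rw [Nat.mul_zero, h.mid_zero]
    exact (Commute.one_right _).smul_right _
  · exact h.commute_two_mid (even_two_mul m) (hlow _ (by lia)) (hlow _ (by lia))

theorem exchange {n : ℕ} (hθ : q - q⁻¹ ≠ 0) (hlow : ∀ j < 2 * n, Commute (a j) (l * l)) {m : ℤ}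
    (hm : m ≤ n) : Exchange (q - q⁻¹) (evenMid a b) (iteratedLie T l) m 0 := by
  unfold Exchange
  rcases lt_or_ge m 0 with hneg | hnn
  · simp [evenMid_of_neg hneg, evenMid_of_neg (show m - 1 < 0 by lia),
      evenMid_of_neg (show m - 2 < 0 by lia)]
  lift m to ℕ using hnn
  match m with
  | 0 =>
    rw [evenMid_of_neg (show ((0 : ℕ) - 1 : ℤ) < 0 by lia),
      evenMid_of_neg (show ((0 : ℕ) - 2 : ℤ) < 0 by lia), evenMid_natCast, Nat.mul_zero, h.mid_zero]
    simp
  | 1 =>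
    rw [show ((1 : ℕ) - 1 : ℤ) = (0 : ℕ) by simp, evenMid_natCast, evenMid_natCast,
      evenMid_of_neg (show ((1 : ℕ) - 2 : ℤ) < 0 by lia), Nat.mul_zero, h.mid_zero, Nat.mul_one,
      h.mid_two]
    simp only [iteratedLie, smul_mul_assoc, mul_smul_comm, one_mul, mul_one, zero_mul, mul_zero,
      smul_sub, mul_sub, sub_mul]
    generalize q - q⁻¹ = θ at hθ ⊢
    match_scalars <;> field_simp <;> ring
  | m + 2 =>
    have hU := h.commute_evenMid hlow (m := (m + 1 : ℕ)) (by lia)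
    have hV := h.commute_evenMid hlow (m := m) (by lia)
    rw [show ((m + 2 : ℕ) - 1 : ℤ) = (m + 1 : ℕ) by push_cast; ring,
      show ((m + 2 : ℕ) - 2 : ℤ) = m by push_cast; ring]
    simp only [evenMid_natCast] at hU hV ⊢
    exact exchange_relation
      (h.lie_mid_add_two (n := 2 * m + 2) (by simp [parity_simps]) (hlow _ (by lia))
        (hlow _ (by lia)))
      (h.mid_add_three (even_two_mul m) fun j hj => hlow j (by lia)) hU hV

theorem lie_evenMid {n : ℕ} (hlow : ∀ j < 2 * n, Commute (a j) (l * l)) {m : ℤ} (h2 : 2 ≤ m)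
    (hm : m ≤ n) : (3 + (q - q⁻¹) ^ 2) • ⁅evenMid a b m, l * l⁆
      = -(4 : ℂ)⁻¹ • ⁅evenMid a b (m - 2), iteratedLie T l 1 * iteratedLie T l 1⁆ := by
  obtain ⟨k, rfl⟩ : ∃ k : ℕ, m = (k + 2 : ℕ) := ⟨(m - 2).toNat, by lia⟩
  have hU := h.commute_evenMid hlow (m := (k + 1 : ℕ)) (by lia)
  have hV := h.commute_evenMid hlow (m := k) (by lia)
  rw [show ((k + 2 : ℕ) - 2 : ℤ) = k by push_cast; ring]
  simp only [evenMid_natCast] at hU hV ⊢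
  have he : Even (2 * k + 2) := by simp [parity_simps]
  exact square_relation
    (h.lie_mid_add_two he (hlow _ (by lia)) (hlow _ (by lia)))
    (h.mid_add_three he fun j hj => hlow j (by lia))
    (h.lie_two_mid he (hlow _ (by lia)) (hlow _ (by lia)))
    (h.mid_add_three (even_two_mul k) fun j hj => hlow j (by lia)) hU hV h.comm

theorem commute_a_lt (hq0 : q ≠ 0) (hq : ∀ n : ℕ, n ≠ 0 → q ^ n ≠ 1) (n : ℕ) :
    ∀ j < 2 * n, Commute (a j) (l * l) := by
  have hθ := sub_inv_ne_zero_of_sq_ne_one hq0 (hq 2 two_ne_zero)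
  induction n with
  | zero => simp
  | succ n ih =>
    suffices Commute (a (2 * n)) (l * l) ∧ Commute (a (2 * n + 1)) (l * l) by
      intro j hj
      rcases show j < 2 * n ∨ j = 2 * n ∨ j = 2 * n + 1 by lia with hj | rfl | rfl
      exacts [ih j hj, this.1, this.2]
    rcases n with _ | n
    · exact ⟨h.commute_a_zero, h.commute_a_one⟩
    have even : Commute (a (2 * n + 2)) (l * l) := by
      apply h.commute_a_of_mid (ih _ (by lia))
      have key := lie_mul_self_eq_zero hq0 hq (t := evenMid a b) (M := iteratedLie T l) (T := T)
        (n := (n + 1 : ℕ)) (fun _ => rfl) (fun m hm => h.commute_evenMid ih hm)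
        (fun m hm => h.exchange hθ ih hm) (fun m hm => evenMid_of_neg hm)
        (by simpa [h.mid_zero] using evenMid_natCast (a := a) (b := b) 0)
        (by simpa [h.mid_two] using evenMid_natCast (a := a) (b := b) 1)
        (fun m h2 hm => h.lie_evenMid ih h2 hm)
        (by
          rw [← lie_mul_self_eq_consecutive (T := T) fun _ => rfl]
          exact sub_eq_zero.2 h.comm.eq) (n + 1) 0 (by simp)
      rw [evenMid_natCast] at key
      exact sub_eq_zero.1 key
    exact ⟨even, h.commute_a_add_three (even_two_mul n) (ih _ (by lia)) even⟩

theorem commute_a (hq0 : q ≠ 0) (hq : ∀ n : ℕ, n ≠ 0 → q ^ n ≠ 1) (j : ℕ) :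
    Commute (a j) (l * l) :=
  h.commute_a_lt hq0 hq (j + 1) j (by lia)

/-- The recursion expressing the odd half sums through the even ones. -/
theorem mid_odd (hq0 : q ≠ 0) (hq : ∀ n : ℕ, n ≠ 0 → q ^ n ≠ 1) (n : ℕ) :
    mid a b (2 * n + 3) = ((q - q⁻¹) / 2) • (l * mid a b (2 * n + 2))
      + ((q - q⁻¹) / 2) • (mid a b (2 * n + 2) * l)
      + (4 : ℂ)⁻¹ • (mid a b (2 * n) * (T * l - l * T) - (T * l - l * T) * mid a b (2 * n)) := by
  have hc := h.commute_a hq0 hq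
  have h3 := h.mid_add_three (even_two_mul n) fun j _ => hc j
  have hV := (h.commute_evenMid (m := n) (n := n + 1) (fun j _ => hc j) (by simp)).eq
  rw [evenMid_natCast] at hV
  linear_combination (norm := skip) (4 : ℂ)⁻¹ • h3 + (4 : ℂ)⁻¹ • (hV * l - l * hV)
  simp only [mul_sub, sub_mul, mul_assoc]
  module

end

end LoopRelations

end LoopRelations

section SerreRelations

variable {A : Type*} [Ring A] [Algebra ℂ A]

/-- Generators `x`, `w 0` subject to the two quantum Serre relations, together with
`l = [x, w 0]` and the root vectors `w n` obtained from `w 0` by bracketing with `l`. -/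
structure SerreRelations (q : ℂ) (x l : A) (w : ℕ → A) : Prop where
  l_eq : l = x * w 0 - q⁻¹ • (w 0 * x)
  w_succ : ∀ n, w (n + 1) = l * w n + (-1 : ℂ) ^ n • (w n * l)
  serre_x : x * (x * l - l * x) = q • ((x * l - l * x) * x)
  serre_w : w 1 * w 0 = q • (w 0 * w 1)

/-- The brackets of `x` with the root vectors. -/
noncomputable def loopA (q : ℂ) (x : A) (w : ℕ → A) : ℕ → A
  | 0 => (q - q⁻¹)⁻¹ • 1
  | n + 1 => x * w n - q⁻¹ • (w n * x)

/-- The brackets of `x * l - l * x` with the root vectors. -/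
noncomputable def loopB (q : ℂ) (x l : A) (w : ℕ → A) : ℕ → A
  | 0 => (q - q⁻¹)⁻¹ • 1
  | 1 => loopA q x w 1
  | n + 2 => (x * l - l * x) * w n + ((-1) ^ n * q⁻¹) • (w n * (x * l - l * x))

namespace SerreRelations

variable {q : ℂ} {x l : A} {w : ℕ → A}

section

variable (h : SerreRelations q x l w)
include h

theorem w_add_two (n : ℕ) : w (n + 2) = l * l * w n - w n * (l * l) := by
  rw [h.w_succ, h.w_succ]
  rcases neg_one_pow_eq_or ℂ n with hn | hn <;> rw [pow_succ, hn] <;>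
  · simp only [mul_add, add_mul, smul_mul_assoc, mul_smul_comm, mul_assoc]
    module

theorem loopA_one : loopA q x w 1 = l := h.l_eq.symm

theorem loopB_succ (n : ℕ) : loopB q x l w (n + 1)
    = loopA q x w (n + 1) + (-1 : ℂ) ^ n • (loopA q x w n * l) - l * loopA q x w n := by
  rcases n with _ | n
  · simp [loopA, loopB]
  · rw [loopB, loopA, loopA, h.w_succ]
    rcases neg_one_pow_eq_or ℂ n with hn | hn <;> rw [pow_succ, hn] <;>
    · simp only [mul_add, add_mul, mul_sub, sub_mul, smul_mul_assoc, mul_smul_comm, mul_assoc]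
      module

theorem loopB_two : loopB q x l w 2 = loopA q x w 2 - (2 : ℂ) • (l * l) := by
  rw [h.loopB_succ, h.loopA_one]
  module

theorem loopB_three : loopB q x l w 3 = loopA q x w 3 + loopA q x w 2 * l - l * loopA q x w 2 := by
  simp [h.loopB_succ]

end

/-- The half sum of the two brackets of weight two. -/
noncomputable def midTwo (q : ℂ) (x l : A) (w : ℕ → A) : A :=
  (2 : ℂ)⁻¹ • (loopA q x w 2 + loopB q x l w 2)

section

variable (h : SerreRelations q x l w)
include h

theorem loopA_two : loopA q x w 2 = midTwo q x l w + l * l := by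
  rw [midTwo, h.loopB_two]
  module

theorem loopB_two_eq_midTwo_sub : loopB q x l w 2 = midTwo q x l w - l * l := by
  rw [midTwo, h.loopB_two]
  module

theorem lie_loopB_two (hq0 : q ≠ 0) : loopB q x l w 2 * x - x * loopB q x l w 2
    = -q⁻¹ • (l * (x * l - l * x)) - q • ((x * l - l * x) * l) := by
  have hx := h.serre_x
  have hl := h.l_eq
  simp only [loopB, pow_zero, one_mul]
  generalize x * l - l * x = x₂ at *
  linear_combination (norm := skip) -(hx * w 0) - (q⁻¹ ^ 2) • (w 0 * hx) + q⁻¹ • (hl * x₂)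
    + q • (x₂ * hl)
  simp only [mul_add, add_mul, mul_sub, sub_mul, smul_mul_assoc, mul_smul_comm, mul_assoc]
  match_scalars <;> field_simp <;> ring

theorem lie_loopB_three (hq0 : q ≠ 0) : loopB q x l w 3 * x - x * loopB q x l w 3
    = q⁻¹ • (loopA q x w 2 * (x * l - l * x)) - q • ((x * l - l * x) * loopA q x w 2) := by
  have hx := h.serre_x
  simp only [loopB, loopA, pow_one]
  generalize x * l - l * x = x₂ at *
  linear_combination (norm := skip) -(hx * w 1) + (q⁻¹ ^ 2) • (w 1 * hx)
  simp only [mul_add, add_mul, mul_sub, sub_mul, smul_mul_assoc, mul_smul_comm, mul_assoc]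
  match_scalars <;> field_simp <;> ring

theorem lie_loopA_two (hq0 : q ≠ 0) : loopA q x w 2 * w 0 - w 0 * loopA q x w 2
    = q • (l * w 1) - q⁻¹ • (w 1 * l) := by
  have hw := h.serre_w
  have hl := h.l_eq
  simp only [loopA]
  linear_combination (norm := skip) x * hw - (q⁻¹ ^ 2) • (hw * x) - q • (hl * w 1)
    + q⁻¹ • (w 1 * hl)
  simp only [mul_sub, sub_mul, smul_mul_assoc, mul_smul_comm, mul_assoc]
  match_scalars <;> field_simp <;> ring

theorem loopB_three_mul_add (hq0 : q ≠ 0) : loopB q x l w 3 * w 0 + w 0 * loopB q x l w 3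
    = q • (loopB q x l w 2 * w 1) - q⁻¹ • (w 1 * loopB q x l w 2) := by
  have hw := h.serre_w
  simp only [loopB, pow_zero, one_mul, pow_one]
  generalize x * l - l * x = x₂ at *
  linear_combination (norm := skip) x₂ * hw + (q⁻¹ ^ 2) • (hw * x₂)
  simp only [mul_add, add_mul, smul_mul_assoc, mul_smul_comm, mul_assoc]
  match_scalars <;> field_simp <;> ring

theorem lie_midTwo_x (hq0 : q ≠ 0) : midTwo q x l w * x - x * midTwo q x l w
    = -(1 + q⁻¹) • (l * (x * l - l * x)) - (1 + q) • ((x * l - l * x) * l) := by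
  have e := h.lie_loopB_two hq0
  rw [h.loopB_two_eq_midTwo_sub] at e
  linear_combination (norm := skip) e
  simp only [mul_sub, sub_mul, mul_assoc]
  module

theorem lie_midTwo_w_zero (hq0 : q ≠ 0) : midTwo q x l w * w 0 - w 0 * midTwo q x l w
    = (q - 1) • (l * w 1) + (1 - q⁻¹) • (w 1 * l) := by
  have e := h.lie_loopA_two hq0
  rw [h.loopA_two] at e
  have e1 := h.w_succ 0
  rw [pow_zero, one_smul, zero_add] at e1
  linear_combination (norm := skip) e + l * e1 - e1 * l
  simp only [mul_add, add_mul, mul_assoc]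
  module

theorem lie_loopA {T : A} {n : ℕ} (hq0 : q ≠ 0)
    (hx : T * x - x * T = -(1 + q⁻¹) • (l * (x * l - l * x)) - (1 + q) • ((x * l - l * x) * l))
    (hw : T * w n - w n * T = (q - (-1) ^ n) • (l * w (n + 1))
      + (1 - (-1) ^ n * q⁻¹) • (w (n + 1) * l)) :
    T * loopA q x w (n + 1) - loopA q x w (n + 1) * T
      = (q - q⁻¹) • (l * (loopB q x l w (n + 2) + loopA q x w (n + 2)))
        + (q - q⁻¹) • loopB q x l w (n + 3)
        - (q + 1) • (loopA q x w (n + 1) * (l * l) - l * l * loopA q x w (n + 1)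
          + loopA q x w (n + 3))
        + (q⁻¹ - (-1) ^ n) • loopA q x w (n + 3) := by
  simp only [loopA, loopB, h.w_add_two, h.w_succ, pow_succ] at hw ⊢
  linear_combination (norm := skip) hx * w n + x * hw - q⁻¹ • (hw * x + w n * hx)
  simp only [mul_add, add_mul, mul_sub, sub_mul, smul_mul_assoc, mul_smul_comm, mul_assoc]
  rcases neg_one_pow_eq_or ℂ n with hn | hn <;> rw [hn] <;>
  · match_scalars <;> field_simp <;> ring

theorem lie_loopB {T : A} {n : ℕ} (hq0 : q ≠ 0)
    (hx : T * (x * l - l * x) - (x * l - l * x) * T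
      = -(1 - q⁻¹) • (l * ((x * l - l * x) * l + l * (x * l - l * x)))
        - (q - 1) • (((x * l - l * x) * l + l * (x * l - l * x)) * l))
    (hw : T * w n - w n * T = (q - (-1) ^ n) • (l * w (n + 1))
      + (1 - (-1) ^ n * q⁻¹) • (w (n + 1) * l)) :
    T * loopB q x l w (n + 2) - loopB q x l w (n + 2) * T
      = -(q - q⁻¹) • (l * (loopA q x w (n + 1) * (l * l) - l * l * loopA q x w (n + 1)
          + loopA q x w (n + 3) + loopB q x l w (n + 3)))
        + (q - q⁻¹) • (loopA q x w (n + 2) * (l * l) - l * l * loopA q x w (n + 2)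
          + loopA q x w (n + 4))
        - (q - 1) • (loopB q x l w (n + 2) * (l * l) - l * l * loopB q x l w (n + 2)
          + loopB q x l w (n + 4))
        + (q⁻¹ + (-1) ^ (n + 1)) • loopB q x l w (n + 4) := by
  simp only [loopA, loopB, h.w_add_two, h.w_succ, pow_succ] at hw ⊢
  have hs := neg_one_pow_eq_or ℂ n
  generalize (-1 : ℂ) ^ n = s at *
  linear_combination (norm := skip) hx * w n + (x * l - l * x) * hw
    + (s * q⁻¹) • (hw * (x * l - l * x) + w n * hx)
  simp only [mul_add, add_mul, mul_sub, sub_mul, smul_mul_assoc, mul_smul_comm, mul_assoc]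
  rcases hs with rfl | rfl <;>
  · match_scalars <;> field_simp <;> ring

theorem loopA_three (hq0 : q ≠ 0) : loopA q x w 3
    = (q - q⁻¹) • (l * midTwo q x l w)
      + ((q - q⁻¹ - 1) / 2) • (midTwo q x l w * l - l * midTwo q x l w) := by
  have e := h.lie_loopA (n := 0) hq0 (h.lie_midTwo_x hq0) (by simpa using h.lie_midTwo_w_zero hq0)
  simp only [zero_add, pow_zero, h.loopB_three, h.loopB_two_eq_midTwo_sub, h.loopA_one,
    h.loopA_two] at e
  linear_combination (norm := skip) (2⁻¹ : ℂ) • e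
  simp only [mul_add, add_mul, mul_sub, mul_assoc]
  module

theorem loopB_three_eq (hq0 : q ≠ 0) : loopB q x l w 3
    = ((q - q⁻¹ + 1) / 2) • (midTwo q x l w * l) + ((q - q⁻¹ - 1) / 2) • (l * midTwo q x l w) := by
  rw [h.loopB_three, h.loopA_three hq0, h.loopA_two]
  simp only [mul_add, add_mul, mul_assoc]
  module

theorem lie_midTwo_lie (hq0 : q ≠ 0) (hq : q ^ 3 ≠ 1) :
    midTwo q x l w * (x * l - l * x) - (x * l - l * x) * midTwo q x l w
      = -(1 - q⁻¹) • (l * ((x * l - l * x) * l + l * (x * l - l * x)))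
        - (q - 1) • (((x * l - l * x) * l + l * (x * l - l * x)) * l) := by
  have e := h.lie_loopB_three hq0
  have ex := h.lie_midTwo_x hq0
  have hc : (q + q⁻¹ + 1) / 2 ≠ 0 := by
    intro h0
    apply hq
    field_simp at h0
    linear_combination (q - 1) * h0
  rw [h.loopB_three_eq hq0, h.loopA_two] at e
  generalize midTwo q x l w = T at *
  rw [← sub_eq_zero, ← smul_eq_zero_iff_right hc]
  linear_combination (norm := skip) -e + ((q - q⁻¹ + 1) / 2) • (ex * l)
    + ((q - q⁻¹ - 1) / 2) • (l * ex)
  simp only [mul_add, add_mul, mul_sub, sub_mul, smul_mul_assoc, mul_smul_comm, mul_assoc]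
  match_scalars <;> field_simp <;> ring

theorem lie_midTwo_w_one (hq0 : q ≠ 0) (hq : q ^ 6 ≠ 1) :
    midTwo q x l w * w 1 - w 1 * midTwo q x l w
      = (q + 1) • (l * w 2) + (1 + q⁻¹) • (w 2 * l) := by
  have e := h.loopB_three_mul_add hq0
  have ew := h.lie_midTwo_w_zero hq0
  have hc : (q + q⁻¹ - 1) / 2 ≠ 0 := by
    intro h0
    apply hq
    field_simp at h0
    linear_combination (q + 1) * (q ^ 3 - 1) * h0
  rw [h.loopB_three_eq hq0, h.loopB_two_eq_midTwo_sub] at e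
  generalize midTwo q x l w = T at *
  rw [← sub_eq_zero, ← smul_eq_zero_iff_right hc]
  simp only [h.w_add_two 0, h.w_succ 0, pow_zero, one_smul] at *
  linear_combination (norm := skip) -e - ((q - q⁻¹ + 1) / 2) • (ew * l)
    + ((q - q⁻¹ - 1) / 2) • (l * ew)
  simp only [mul_add, add_mul, mul_sub, sub_mul, smul_mul_assoc, mul_smul_comm, mul_assoc]
  match_scalars <;> field_simp <;> ring

theorem commute_midTwo (hq0 : q ≠ 0) (hq : ∀ n : ℕ, n ≠ 0 → q ^ n ≠ 1) :
    Commute (midTwo q x l w) (l * l) := by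
  have ea := h.lie_loopA (n := 1) hq0 (h.lie_midTwo_x hq0)
    (by simpa using h.lie_midTwo_w_one hq0 (hq 6 (by norm_num)))
  have eb := h.lie_loopB (n := 0) hq0 (h.lie_midTwo_lie hq0 (hq 3 (by norm_num)))
    (by simpa using h.lie_midTwo_w_zero hq0)
  have hc : q + q⁻¹ ≠ 0 := by
    intro h0
    apply hq 4 (by norm_num)
    field_simp at h0
    linear_combination (q ^ 2 - 1) * h0
  simp only [Nat.reduceAdd, zero_add, h.loopA_one, h.loopA_two, h.loopB_two_eq_midTwo_sub] at ea eb
  generalize midTwo q x l w = T at *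
  rw [commute_iff_eq, ← sub_eq_zero, ← smul_eq_zero_iff_right hc]
  linear_combination (norm := skip) ea + eb
  simp only [mul_add, add_mul, mul_sub, sub_mul, mul_assoc]
  match_scalars <;> field_simp <;> ring

theorem lie_midTwo_w (hq0 : q ≠ 0) (hq : ∀ n : ℕ, n ≠ 0 → q ^ n ≠ 1) (n : ℕ) :
    midTwo q x l w * w n - w n * midTwo q x l w
      = (q - (-1) ^ n) • (l * w (n + 1)) + (1 - (-1) ^ n * q⁻¹) • (w (n + 1) * l) := by
  induction n using Nat.twoStepInduction with
  | zero => simpa using h.lie_midTwo_w_zero hq0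
  | one => simpa using h.lie_midTwo_w_one hq0 (hq 6 (by norm_num))
  | more n ih _ =>
    have hc := (h.commute_midTwo hq0 hq).eq
    rw [h.w_add_two, h.w_add_two, pow_add, neg_one_sq, mul_one]
    linear_combination (norm := skip) l * l * ih - ih * (l * l) + hc * w n - w n * hc
    simp only [mul_add, add_mul, mul_sub, sub_mul, smul_mul_assoc, mul_smul_comm, mul_assoc]
    module

theorem loopRelations (hq0 : q ≠ 0) (hq : ∀ n : ℕ, n ≠ 0 → q ^ n ≠ 1) :
    LoopRelations q l (midTwo q x l w) (loopA q x w) (loopB q x l w) where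
  a_zero := rfl
  a_one := h.loopA_one
  b_zero := rfl
  b_succ := h.loopB_succ
  two := rfl
  comm := h.commute_midTwo hq0 hq
  lie_a n := h.lie_loopA hq0 (h.lie_midTwo_x hq0) (h.lie_midTwo_w hq0 hq n)
  lie_b n := by
    rcases n with _ | n
    · have e := h.loopA_three hq0
      have hθ := sub_inv_ne_zero_of_sq_ne_one hq0 (hq 2 two_ne_zero)
      have hb : loopB q x l w 1 = l := h.loopA_one
      have ha : loopA q x w 0 = (q - q⁻¹)⁻¹ • 1 := rfl
      simp only [zero_add, pow_zero, h.loopB_three, h.loopB_two_eq_midTwo_sub, h.loopA_one,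
        h.loopA_two, e, ha, hb, smul_mul_assoc, mul_smul_comm, one_mul, mul_one, mul_add, add_mul,
        mul_sub, mul_assoc]
      match_scalars <;> field_simp <;> ring
    · exact h.lie_loopB hq0 (h.lie_midTwo_lie hq0 (hq 3 (by norm_num))) (h.lie_midTwo_w hq0 hq n)

end

end SerreRelations

end SerreRelations

namespace QAff

theorem Y_add_two (q : ℂ) (n : ℕ) :
    Y q (n + 2) = L1U q * Y q (n + 1) + (-1 : ℂ) ^ n • (Y q (n + 1) * L1U q) := by
  rw [Y, pow_succ]
  module

theorem serreRelations (q : ℂ) : SerreRelations q (π q x1) (L1U q) fun n => Y q (n + 1) where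
  l_eq := rfl
  w_succ := Y_add_two q
  serre_x := by
    have e : π q (serre1 q) = 0 := (RingQuot.mkAlgHom_rel ℂ Rel.one).trans (map_zero _)
    rw [← sub_eq_zero, ← e]
    simp [serre1, X2F, L1F, L1U]
  serre_w := by
    have e : π q (serre2 q) = 0 := (RingQuot.mkAlgHom_rel ℂ Rel.two).trans (map_zero _)
    have e2 : Y q 2 = L1U q * π q x2 + π q x2 * L1U q := by simpa [Y] using Y_add_two q 0
    change Y q 2 * π q x2 = q • (π q x2 * Y q 2)
    rw [e2, ← sub_eq_zero, ← e]
    simp [serre2, Y2F, L1F, L1U]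

theorem L_eq_loopA (q : ℂ) : L q = loopA q (π q x1) fun n => Y q (n + 1) := by
  funext n
  cases n <;> rfl

theorem L'_eq_loopB (q : ℂ) : L' q = loopB q (π q x1) (L1U q) fun n => Y q (n + 1) := by
  funext n
  rcases n with _ | _ | n
  · rfl
  · rw [L', L_eq_loopA]
    rfl
  · have e : X q 2 = π q x1 * L1U q - L1U q * π q x1 := by simp [X]
    rw [L', loopB, e, pow_succ]
    module

theorem Lt_natCast (q : ℂ) (n : ℕ) : Lt q n = LoopRelations.mid (L q) (L' q) n := by
  simp [Lt, LoopRelations.mid]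

end QAff

/-- In `U = U_q(A(0,2)^{(4)})^+`, for every `n ≥ 0`:
`L̃_{2n+1} = (θ/2)L₁L̃_{2n} + (θ/2)L̃_{2n}L₁ + (1/4)[L̃_{2n-2}, M₃]`,
with `[L̃_{2n-2}, M₃] = L̃_{2n-2}M₃ - M₃L̃_{2n-2}` a plain commutator and the
conventions `L̃₀ = θ⁻¹·1`, `L̃₋₂ = 0`. -/
theorem stmt9 (q : ℂ) (hq0 : q ≠ 0) (hq : NotRootOfUnity q) (n : ℕ) :
    Lt q (2*(n : ℤ)+1)
      = (θ q / 2) • (L q 1 * Lt q (2*(n : ℤ)))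
        + (θ q / 2) • (Lt q (2*(n : ℤ)) * L q 1)
        + (4 : ℂ)⁻¹ • (Lt q (2*(n : ℤ) - 2) * M q 1 - M q 1 * Lt q (2*(n : ℤ) - 2)) := by
  have h := (serreRelations q).loopRelations hq0 hq
  rw [← L_eq_loopA, ← L'_eq_loopB] at h
  rw [h.a_one]
  rcases n with _ | n
  · have hθ := sub_inv_ne_zero_of_sq_ne_one hq0 (hq 2 two_ne_zero)
    have e1 : Lt q 1 = L1U q := by
      rw [← Nat.cast_one, Lt_natCast, LoopRelations.mid, L', h.a_one]
      module
    have e0 : Lt q 0 = (θ q)⁻¹ • 1 := (Lt_natCast q 0).trans h.mid_zero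
    have e2 : Lt q (-2) = 0 := by simp [Lt]
    simp only [Nat.cast_zero, mul_zero, zero_add, zero_sub, e0, e1, e2, zero_mul, sub_zero,
      smul_zero, add_zero, mul_smul_comm, smul_mul_assoc, mul_one, one_mul]
    rw [θ]
    match_scalars
    simp only [mul_one]
    linear_combination -mul_inv_cancel₀ hθ
  · have hM : M q 1 = SerreRelations.midTwo q (π q x1) (L1U q) (fun n => Y q (n + 1)) * L1U q
        - L1U q * SerreRelations.midTwo q (π q x1) (L1U q) (fun n => Y q (n + 1)) := by
      rw [M, M, h.a_one, L_eq_loopA, (serreRelations q).loopA_two]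
      simp only [add_mul, mul_add, mul_assoc]
      abel
    have e := h.mid_odd hq0 hq n
    rw [← hM, ← Lt_natCast, ← Lt_natCast, ← Lt_natCast] at e
    have e3 : 2 * ((n + 1 : ℕ) : ℤ) + 1 = (2 * n + 3 : ℕ) := by push_cast; ring
    have e2 : 2 * ((n + 1 : ℕ) : ℤ) = (2 * n + 2 : ℕ) := by push_cast; ring
    have e0 : 2 * ((n + 1 : ℕ) : ℤ) - 2 = (2 * n : ℕ) := by push_cast; ring
    rw [e3, e0, e2]
    exact e
end
end

section
/- In U = U_q(A(0,2)^{(4)})^+, for every n ≥ 1: [L̃_{2n}, L₁] = (θ/2)·M₃L̃_{2n−2} + (θ/2)·L̃_{2n−2}M₃ + (1/4)·[L̃_{2n−4}, M₅], where [L̃_{2n}, L₁] = L̃_{2n}L₁ − L₁L̃_{2n} and [L̃_{2n−4}, M₅] = L̃_{2n−4}M₅ − M₅L̃_{2n−4} are plain commutators and the conventions L̃₀ = θ⁻¹·1, L̃_n = 0 for n < 0 are used. -/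
noncomputable section

namespace QAff

section

variable {A : Type*} [Ring A] [Algebra ℂ A]

/-- Real root vectors: `x i` stands for `X_{i+1}`, `y j` for `Y_{j+1}` and `b` for `L₁`. -/
structure IsRootSystem (q : ℂ) (x y : ℕ → A) (b : A) : Prop where
  b_eq : x 0 * y 0 - q⁻¹ • (y 0 * x 0) = b
  x_succ : ∀ i, x (i + 1) = x i * b - (-1 : ℂ) ^ i • (b * x i)
  y_succ : ∀ j, y (j + 1) = b * y j + (-1 : ℂ) ^ j • (y j * b)
  serre_x : x 0 * x 1 = q • (x 1 * x 0)
  serre_y : y 1 * y 0 = q • (y 0 * y 1)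

/-- The braided bracket `[X_{i+1}, Y_{j+1}]`. -/
def Z (q : ℂ) (x y : ℕ → A) (i j : ℕ) : A :=
  x i * y j - ((-1 : ℂ) ^ (i * (j + 1)) * q⁻¹) • (y j * x i)

lemma lie_x_zero_of_serre (q : ℂ) (hq : q ≠ 0) (x0 x1 y0 b : A) (hb : x0 * y0 - q⁻¹ • (y0 * x0) = b)
    (l' : A) (hl' : x1 * y0 + q⁻¹ • (y0 * x1) = l') (hs : x0 * x1 = q • (x1 * x0)) :
    x0 * l' - l' * x0 = q • (x1 * b) + q⁻¹ • (b * x1) := by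
  subst hb hl'
  linear_combination (norm := skip) hs * y0 + (q⁻¹ * q⁻¹) • (y0 * hs)
  simp only [mul_add, add_mul, mul_sub, sub_mul, smul_mul_assoc, mul_smul_comm, smul_sub,
    smul_smul, mul_assoc]
  match_scalars <;> field_simp <;> ring

lemma lie_y_zero_of_serre (q : ℂ) (hq : q ≠ 0) (x0 y0 y1 b : A) (hb : x0 * y0 - q⁻¹ • (y0 * x0) = b)
    (l : A) (hl : x0 * y1 - q⁻¹ • (y1 * x0) = l) (hs : y1 * y0 = q • (y0 * y1)) :
    l * y0 - y0 * l = q • (b * y1) - q⁻¹ • (y1 * b) := by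
  subst hb hl
  linear_combination (norm := skip) x0 * hs - (q⁻¹ * q⁻¹) • (hs * x0)
  simp only [mul_sub, sub_mul, smul_mul_assoc, mul_smul_comm, smul_sub, smul_smul, mul_assoc]
  match_scalars <;> field_simp <;> ring

lemma two_smul_braided_x_one_y_one (q : ℂ) (hq : q ≠ 0) (x0 x1 y0 y1 b l : A)
    (hb : x0 * y0 - q⁻¹ • (y0 * x0) = b) (h1 : x0 * b = b * x0 + x1) (h2 : b * y0 = y1 - y0 * b)
    (hl : x0 * y1 - q⁻¹ • (y1 * x0) = l + b * b)
    (hl' : x1 * y0 + q⁻¹ • (y0 * x1) = l - b * b)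
    (hX : x0 * l - l * x0 = (q + 1) • (x1 * b) + (1 + q⁻¹) • (b * x1))
    (hY : l * y0 - y0 * l = (q - 1) • (b * y1) + (1 - q⁻¹) • (y1 * b)) :
    (2 : ℂ) • (x1 * y1 - q⁻¹ • (y1 * x1)) =
     (q - q⁻¹ - 1) • (b * l) + (q - q⁻¹ + 1) • (l * b) := by
  linear_combination (norm := skip) hb * l - l * hb - hX * y0 + q⁻¹ • (y0 * hX) + x0 * hY
    - q⁻¹ • (hY * x0) - (q + 1) • (x1 * h2) + (q⁻¹ * (1 + q⁻¹)) • (h2 * x1)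
    + (q - 1) • (h1 * y1) + (q⁻¹ * (1 - q⁻¹)) • (y1 * h1) + (q + 1) • (hl' * b)
    - (1 + q⁻¹) • (b * hl') + (q - 1) • (b * hl) + (1 - q⁻¹) • (hl * b)
  simp only [mul_add, add_mul, mul_sub, sub_mul, smul_mul_assoc, mul_smul_comm, smul_add, smul_sub,
    smul_smul, mul_assoc]
  match_scalars <;> field_simp <;> ring

lemma lie_x_zero_braided_of_serre (q : ℂ) (hq : q ≠ 0) (x0 x1 y1 l z : A)
    (hs : x0 * x1 = q • (x1 * x0))
    (hl : x0 * y1 - q⁻¹ • (y1 * x0) = l) (hz : x1 * y1 - q⁻¹ • (y1 * x1) = z) :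
    x0 * z - z * x0 = q • (x1 * l) - q⁻¹ • (l * x1) := by
  subst hl hz
  linear_combination (norm := skip) hs * y1 - (q⁻¹ * q⁻¹) • (y1 * hs)
  simp only [mul_sub, sub_mul, smul_mul_assoc, mul_smul_comm, smul_sub, smul_smul, mul_assoc]
  match_scalars <;> field_simp <;> ring

lemma lie_braided_y_zero_of_serre (q : ℂ) (hq : q ≠ 0) (x1 y0 y1 l z : A)
    (hs : y1 * y0 = q • (y0 * y1))
    (hl : x1 * y0 + q⁻¹ • (y0 * x1) = l) (hz : x1 * y1 - q⁻¹ • (y1 * x1) = z) :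
    z * y0 + y0 * z = q • (l * y1) - q⁻¹ • (y1 * l) := by
  subst hl hz
  linear_combination (norm := skip) x1 * hs + (q⁻¹ * q⁻¹) • (hs * x1)
  simp only [mul_add, add_mul, mul_sub, sub_mul, smul_mul_assoc, mul_smul_comm, smul_add,
    smul_smul, mul_assoc]
  match_scalars <;> field_simp <;> ring

lemma lie_x_one (q : ℂ) (hq : q ≠ 0) (h3 : q ^ 2 + q + 1 ≠ 0) (x0 x1 x2 b l z : A)
    (h1 : x0 * b = b * x0 + x1) (h2 : x1 * b = x2 - b * x1)
    (hX : x0 * l - l * x0 = (q + 1) • (x1 * b) + (1 + q⁻¹) • (b * x1))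
    (hz : (2 : ℂ) • z = (q - q⁻¹ - 1) • (b * l) + (q - q⁻¹ + 1) • (l * b))
    (hxz : x0 * z - z * x0 = q • (x1 * (l + b * b)) - q⁻¹ • ((l + b * b) * x1)) :
    x1 * l - l * x1 = (q - 1) • (x2 * b) + (1 - q⁻¹) • (b * x2) := by
  have h : (q + 1 + q⁻¹) • (x1 * l - l * x1) =
      (q + 1 + q⁻¹) • ((q - 1) • (x2 * b) + (1 - q⁻¹) • (b * x2)) := by
    linear_combination (norm := skip) (-2 : ℂ) • hxz + x0 * hz - hz * x0
      + (q - q⁻¹ - 1) • (h1 * l) + (q - q⁻¹ - 1) • (b * hX)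
      + (q - q⁻¹ + 1) • (hX * b) + (q - q⁻¹ + 1) • (l * h1)
      + ((q + 1 + q⁻¹) * (q - 1)) • (h2 * b) + ((q + 1 + q⁻¹) * (1 - q⁻¹)) • (b * h2)
    simp only [mul_add, add_mul, mul_sub, sub_mul, smul_mul_assoc, mul_smul_comm, smul_add,
      smul_sub, smul_smul, mul_assoc]
    match_scalars <;> field_simp <;> ring
  have hne : q + 1 + q⁻¹ ≠ 0 := by
    intro h0
    apply h3
    field_simp at h0
    linear_combination h0
  exact smul_right_injective A hne h

lemma lie_y_one (q : ℂ) (hq : q ≠ 0) (h3 : q ^ 2 - q + 1 ≠ 0) (y0 y1 y2 b l z : A)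
    (h1 : b * y0 = y1 - y0 * b) (h2 : b * y1 = y2 + y1 * b)
    (hY : l * y0 - y0 * l = (q - 1) • (b * y1) + (1 - q⁻¹) • (y1 * b))
    (hz : (2 : ℂ) • z = (q - q⁻¹ - 1) • (b * l) + (q - q⁻¹ + 1) • (l * b))
    (hzy : z * y0 + y0 * z = q • ((l - b * b) * y1) - q⁻¹ • (y1 * (l - b * b))) :
    l * y1 - y1 * l = (q + 1) • (b * y2) + (1 + q⁻¹) • (y2 * b) := by
  have h : (q - 1 + q⁻¹) • (l * y1 - y1 * l) =
      (q - 1 + q⁻¹) • ((q + 1) • (b * y2) + (1 + q⁻¹) • (y2 * b)) := by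
    linear_combination (norm := skip) (-2 : ℂ) • hzy + hz * y0 + y0 * hz
      + (q - q⁻¹ + 1) • (l * h1) + (q - q⁻¹ - 1) • (h1 * l)
      + (q - q⁻¹ - 1) • (b * hY) - (q - q⁻¹ + 1) • (hY * b)
      + ((q - 1 + q⁻¹) * (q + 1)) • (b * h2) + ((q - 1 + q⁻¹) * (1 + q⁻¹)) • (h2 * b)
    simp only [mul_add, add_mul, mul_sub, sub_mul, smul_mul_assoc, mul_smul_comm, smul_add,
      smul_sub, smul_smul, mul_assoc]
    match_scalars <;> field_simp <;> ring
  have hne : q - 1 + q⁻¹ ≠ 0 := by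
    intro h0
    apply h3
    field_simp at h0
    linear_combination h0
  exact smul_right_injective A hne h

lemma Z_comm_b {q : ℂ} {x y : ℕ → A} {b : A} (h : IsRootSystem q x y b) (i j : ℕ) :
    Z q x y i j * b - (-1 : ℂ) ^ (i + j + 1) • (b * Z q x y i j) =
      (-1 : ℂ) ^ (j + 1) • (Z q x y (i + 1) j - Z q x y i (j + 1)) := by
  rcases neg_one_pow_eq_or ℂ i with hi | hi <;> rcases neg_one_pow_eq_or ℂ j with hj | hj <;>
  · simp only [Z, h.x_succ, h.y_succ, pow_mul, pow_add, hi, hj, pow_one, one_pow, mul_add, add_mul,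
    mul_sub, sub_mul, smul_mul_assoc, mul_smul_comm, smul_add, smul_sub, smul_smul, mul_assoc]
    match_scalars <;> ring

lemma x_comm_b_sq {q : ℂ} {x y : ℕ → A} {b : A} (h : IsRootSystem q x y b) (i : ℕ) :
    x i * (b * b) - b * b * x i = x (i + 2) := by
  rw [h.x_succ (i + 1), h.x_succ i]
  rcases neg_one_pow_eq_or ℂ i with hi | hi <;>
  · simp only [pow_succ, hi, neg_smul, one_smul, one_mul, neg_mul, mul_neg, neg_neg]
    noncomm_ring

lemma y_comm_b_sq {q : ℂ} {x y : ℕ → A} {b : A} (h : IsRootSystem q x y b) (j : ℕ) :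
    b * b * y j - y j * (b * b) = y (j + 2) := by
  rw [h.y_succ (j + 1), h.y_succ j]
  rcases neg_one_pow_eq_or ℂ j with hj | hj <;>
  · simp only [pow_succ, hj, neg_smul, one_smul, one_mul, neg_mul, mul_neg, neg_neg]
    noncomm_ring

lemma Z_comm_b_sq {q : ℂ} {x y : ℕ → A} {b : A} (h : IsRootSystem q x y b) (i j : ℕ) :
    Z q x y i j * (b * b) - b * b * Z q x y i j = Z q x y (i + 2) j - Z q x y i (j + 2) := by
  simp only [Z, ← x_comm_b_sq h i, ← y_comm_b_sq h j]
  rcases neg_one_pow_eq_or ℂ i with hi | hi <;> rcases neg_one_pow_eq_or ℂ j with hj | hj <;>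
  · simp only [pow_mul, pow_add, hi, hj, pow_one, one_pow, mul_add, add_mul, mul_sub, sub_mul,
    smul_mul_assoc, mul_smul_comm, smul_sub, mul_assoc]
    match_scalars <;> ring

lemma Z_comm_of_comm {q : ℂ} {x y : ℕ → A} {b : A} (h : IsRootSystem q x y b) (w : ℂ) (H : A)
    (i j : ℕ)
    (hx : x i * H - H * x i = (-1 : ℂ) ^ i • x (i + 2) +
      w • (x (i + 1) * b - (-1 : ℂ) ^ i • (b * x (i + 1))))
    (hy : y j * H - H * y j = (-1 : ℂ) ^ j • y (j + 2) -
      w • (b * y (j + 1) + (-1 : ℂ) ^ j • (y (j + 1) * b))) :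
    Z q x y i j * H - H * Z q x y i j =
      (-1 : ℂ) ^ i • Z q x y (i + 2) j + (-1 : ℂ) ^ j • Z q x y i (j + 2) -
        w • ((-1 : ℂ) ^ j • ((Z q x y (i + 1) j + Z q x y i (j + 1)) * b) +
          (-1 : ℂ) ^ i • (b * (Z q x y (i + 1) j + Z q x y i (j + 1)))) := by
  rw [h.x_succ i] at hx
  rw [h.y_succ j] at hy
  simp only [Z, h.x_succ i, h.y_succ j]
  linear_combination (norm := skip) hx * y j + x i * hy
    - ((-1 : ℂ) ^ (i * (j + 1)) * q⁻¹) • (y j * hx)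
    - ((-1 : ℂ) ^ (i * (j + 1)) * q⁻¹) • (hy * x i)
  rcases neg_one_pow_eq_or ℂ i with hi | hi <;> rcases neg_one_pow_eq_or ℂ j with hj | hj <;>
  · simp only [pow_mul, pow_add, hi, hj, pow_one, one_pow, mul_add, add_mul, mul_sub, sub_mul,
    smul_mul_assoc, mul_smul_comm, smul_add, smul_sub, smul_smul, mul_assoc]
    match_scalars <;> ring

/-- The family `L̃_{2k}` extended by zero to all integers `k`. -/
def ell (q : ℂ) (x y : ℕ → A) : ℤ → A
  | .ofNat 0 => (q - q⁻¹)⁻¹ • 1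
  | .ofNat (k + 1) => (2 : ℂ)⁻¹ • (Z q x y 0 (2 * k + 1) + Z q x y 1 (2 * k))
  | .negSucc _ => 0

/-- The combination of `L̃₂` and `L₁²` acting on the real root vectors like a Cartan element. -/
def cartan (q : ℂ) (x y : ℕ → A) (b : A) : A :=
  ell q x y 1 - ((q + q⁻¹) / 2) • (b * b)

lemma ell_one (q : ℂ) (x y : ℕ → A) :
    ell q x y 1 = (2 : ℂ)⁻¹ • (Z q x y 0 1 + Z q x y 1 0) := rfl

lemma ell_succ (q : ℂ) (x y : ℕ → A) (k : ℕ) :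
    ell q x y (k + 1) = (2 : ℂ)⁻¹ • (Z q x y 0 (2 * k + 1) + Z q x y 1 (2 * k)) := rfl

lemma Z_zero_zero {q : ℂ} {x y : ℕ → A} {b : A} (h : IsRootSystem q x y b) :
    Z q x y 0 0 = b := by
  simpa [Z] using h.b_eq

lemma Z_sub_Z {q : ℂ} {x y : ℕ → A} {b : A} (h : IsRootSystem q x y b) (k : ℕ) :
    Z q x y 0 (2 * k + 1) - Z q x y 1 (2 * k) = Z q x y 0 (2 * k) * b + b * Z q x y 0 (2 * k) := by
  have := Z_comm_b h 0 (2 * k)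
  simp [pow_succ] at this
  rw [this]

lemma Z_zero_odd {q : ℂ} {x y : ℕ → A} {b : A} (h : IsRootSystem q x y b) (k : ℕ) :
    Z q x y 0 (2 * k + 1) = ell q x y (k + 1) +
      (2 : ℂ)⁻¹ • (Z q x y 0 (2 * k) * b + b * Z q x y 0 (2 * k)) := by
  rw [ell_succ, ← Z_sub_Z h]
  module

lemma Z_one_even {q : ℂ} {x y : ℕ → A} {b : A} (h : IsRootSystem q x y b) (k : ℕ) :
    Z q x y 1 (2 * k) = ell q x y (k + 1) -
      (2 : ℂ)⁻¹ • (Z q x y 0 (2 * k) * b + b * Z q x y 0 (2 * k)) := by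
  rw [ell_succ, ← Z_sub_Z h]
  module

lemma ell_one_comm {q : ℂ} {x y : ℕ → A} {b : A} (h : IsRootSystem q x y b) (hq : q ≠ 0)
    (h3 : q ^ 2 + q + 1 ≠ 0) (h6 : q ^ 2 - q + 1 ≠ 0) :
    (x 0 * ell q x y 1 - ell q x y 1 * x 0 = (q + 1) • (x 1 * b) + (1 + q⁻¹) • (b * x 1)) ∧
    (ell q x y 1 * y 0 - y 0 * ell q x y 1 = (q - 1) • (b * y 1) + (1 - q⁻¹) • (y 1 * b)) ∧
    (x 1 * ell q x y 1 - ell q x y 1 * x 1 = (q - 1) • (x 2 * b) + (1 - q⁻¹) • (b * x 2)) ∧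
    (ell q x y 1 * y 1 - y 1 * ell q x y 1 = (q + 1) • (b * y 2) + (1 + q⁻¹) • (y 2 * b)) := by
  have hx0 : x 0 * b = b * x 0 + x 1 := by rw [h.x_succ 0]; simp
  have hx1 : x 1 * b = x 2 - b * x 1 := by rw [h.x_succ 1]; simp
  have hy0 : b * y 0 = y 1 - y 0 * b := by rw [h.y_succ 0]; simp
  have hy1 : b * y 1 = y 2 + y 1 * b := by rw [h.y_succ 1]; simp
  have h01 := Z_zero_odd h 0
  have h10 := Z_one_even h 0
  simp only [mul_zero, zero_add, Nat.cast_zero, Z_zero_zero h, ← two_smul ℂ (b * b),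
    smul_smul] at h01 h10
  norm_num [Z] at h01 h10
  generalize ell q x y 1 = l at *
  have hX : x 0 * l - l * x 0 = (q + 1) • (x 1 * b) + (1 + q⁻¹) • (b * x 1) := by
    have := lie_x_zero_of_serre q hq _ _ _ _ h.b_eq _ h10 h.serre_x
    linear_combination (norm := skip) this + hx0 * b + b * hx0
    simp only [mul_add, add_mul, mul_sub, sub_mul, mul_assoc]
    module
  have hY : l * y 0 - y 0 * l = (q - 1) • (b * y 1) + (1 - q⁻¹) • (y 1 * b) := by
    have := lie_y_zero_of_serre q hq _ _ _ _ h.b_eq _ h01 h.serre_y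
    linear_combination (norm := skip) this - b * hy0 + hy0 * b
    simp only [mul_add, add_mul, mul_sub, sub_mul, mul_assoc]
    module
  have hZ := two_smul_braided_x_one_y_one q hq _ _ _ _ b l h.b_eq hx0 hy0 h01 h10 hX hY
  exact ⟨hX, hY,
    lie_x_one q hq h3 _ _ _ b l _ hx0 hx1 hX hZ (lie_x_zero_braided_of_serre q hq _ _ _ _ _
      h.serre_x h01 rfl),
    lie_y_one q hq h6 _ _ _ b l _ hy0 hy1 hY hZ (lie_braided_y_zero_of_serre q hq _ _ _ _ _
      h.serre_y h10 rfl)⟩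

lemma x_comm_cartan_of_le_one {q : ℂ} {x y : ℕ → A} {b : A} (h : IsRootSystem q x y b) (hq : q ≠ 0)
    (h3 : q ^ 2 + q + 1 ≠ 0) (h6 : q ^ 2 - q + 1 ≠ 0) (i : ℕ) (hi : i ≤ 1) :
    x i * cartan q x y b - cartan q x y b * x i = (-1 : ℂ) ^ i • x (i + 2) +
      ((q - q⁻¹) / 2) • (x (i + 1) * b - (-1 : ℂ) ^ i • (b * x (i + 1))) := by
  obtain ⟨hX, -, hX', -⟩ := ell_one_comm h hq h3 h6
  have hS := x_comm_b_sq h i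
  have hi' := h.x_succ (i + 1)
  rw [cartan]
  generalize ell q x y 1 = l at *
  interval_cases i
  · simp only [zero_add, pow_one, pow_zero, one_smul, neg_smul, sub_neg_eq_add] at hi' hS ⊢
    linear_combination (norm := skip) hX - ((q + q⁻¹) / 2) • hS - ((q + q⁻¹) / 2 + 1) • hi'
    simp only [mul_sub, sub_mul, smul_mul_assoc, mul_smul_comm, mul_assoc]
    module
  · simp only [Nat.reduceAdd, pow_one, one_smul, neg_smul, sub_neg_eq_add, neg_one_sq] at hi' hS ⊢
    linear_combination (norm := skip) hX' - ((q + q⁻¹) / 2) • hS + (1 - (q + q⁻¹) / 2) • hi'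
    simp only [mul_sub, sub_mul, smul_mul_assoc, mul_smul_comm, mul_assoc]
    module

lemma y_comm_cartan_of_le_one {q : ℂ} {x y : ℕ → A} {b : A} (h : IsRootSystem q x y b) (hq : q ≠ 0)
    (h3 : q ^ 2 + q + 1 ≠ 0) (h6 : q ^ 2 - q + 1 ≠ 0) (j : ℕ) (hj : j ≤ 1) :
    y j * cartan q x y b - cartan q x y b * y j = (-1 : ℂ) ^ j • y (j + 2) -
      ((q - q⁻¹) / 2) • (b * y (j + 1) + (-1 : ℂ) ^ j • (y (j + 1) * b)) := by
  obtain ⟨-, hY, -, hY'⟩ := ell_one_comm h hq h3 h6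
  have hS := y_comm_b_sq h j
  have hi' := h.y_succ (j + 1)
  rw [cartan]
  generalize ell q x y 1 = l at *
  interval_cases j
  · simp only [zero_add, pow_one, pow_zero, one_smul, neg_smul] at hi' hS ⊢
    linear_combination (norm := skip) ((q + q⁻¹) / 2) • hS - hY + ((q + q⁻¹) / 2 - 1) • hi'
    simp only [mul_sub, sub_mul, smul_mul_assoc, mul_smul_comm, mul_assoc]
    module
  · simp only [Nat.reduceAdd, pow_one, one_smul, neg_smul, neg_one_sq] at hi' hS ⊢
    linear_combination (norm := skip) ((q + q⁻¹) / 2) • hS - hY' + (1 + (q + q⁻¹) / 2) • hi'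
    simp only [mul_sub, sub_mul, smul_mul_assoc, mul_smul_comm, mul_assoc]
    module

lemma ell_one_comm_cartan {q : ℂ} {x y : ℕ → A} {b : A} (h : IsRootSystem q x y b) (hq : q ≠ 0)
    (h3 : q ^ 2 + q + 1 ≠ 0) (h6 : q ^ 2 - q + 1 ≠ 0) :
    ell q x y 1 * cartan q x y b = cartan q x y b * ell q x y 1 := by
  have h01 := Z_comm_of_comm h _ _ 0 1 (x_comm_cartan_of_le_one h hq h3 h6 0 zero_le_one)
    (y_comm_cartan_of_le_one h hq h3 h6 1 le_rfl)
  have h10 := Z_comm_of_comm h _ _ 1 0 (x_comm_cartan_of_le_one h hq h3 h6 1 le_rfl)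
    (y_comm_cartan_of_le_one h hq h3 h6 0 zero_le_one)
  have hS := Z_comm_b_sq h 0 0
  have hS1 := Z_comm_b_sq h 0 1
  have hS2 := Z_comm_b_sq h 1 0
  have h1 := Z_sub_Z h 0
  simp only [Z_zero_zero h, mul_zero, zero_add, pow_zero, pow_one, one_smul, neg_smul,
    Nat.reduceAdd] at h01 h10 hS hS1 hS2 h1
  generalize cartan q x y b = H at *
  rw [ell_one, ← sub_eq_zero]
  linear_combination (norm := skip) (2 : ℂ)⁻¹ • (h01 + h10 - hS1 + hS2 + h1 * (b * b) - b * b * h1)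
    + ((q - q⁻¹) / 4) • (hS * b - b * hS)
  simp only [mul_add, add_mul, mul_sub, sub_mul, smul_mul_assoc, mul_smul_comm, mul_assoc]
  module

lemma ell_one_comm_b_sq {q : ℂ} {x y : ℕ → A} {b : A} (h : IsRootSystem q x y b) (hq : q ≠ 0)
    (h3 : q ^ 2 + q + 1 ≠ 0) (h6 : q ^ 2 - q + 1 ≠ 0) (h4 : q ^ 2 + 1 ≠ 0) :
    ell q x y 1 * (b * b) = b * b * ell q x y 1 := by
  have hne : (q + q⁻¹) / 2 ≠ 0 := by
    intro h0
    apply h4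
    field_simp at h0
    linear_combination h0
  refine smul_right_injective A hne ?_
  have := ell_one_comm_cartan h hq h3 h6
  simp only [cartan, mul_sub, sub_mul, smul_mul_assoc, mul_smul_comm] at this ⊢
  exact sub_right_injective this

lemma cartan_comm_b_sq {q : ℂ} {x y : ℕ → A} {b : A} (h : IsRootSystem q x y b) (hq : q ≠ 0)
    (h3 : q ^ 2 + q + 1 ≠ 0) (h6 : q ^ 2 - q + 1 ≠ 0) (h4 : q ^ 2 + 1 ≠ 0) :
    cartan q x y b * (b * b) = b * b * cartan q x y b := by
  simp only [cartan, mul_sub, sub_mul, smul_mul_assoc, mul_smul_comm,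
    ell_one_comm_b_sq h hq h3 h6 h4]

lemma x_comm_cartan {q : ℂ} {x y : ℕ → A} {b : A} (h : IsRootSystem q x y b) (hq : q ≠ 0)
    (h3 : q ^ 2 + q + 1 ≠ 0) (h6 : q ^ 2 - q + 1 ≠ 0) (h4 : q ^ 2 + 1 ≠ 0) (i : ℕ) :
    x i * cartan q x y b - cartan q x y b * x i = (-1 : ℂ) ^ i • x (i + 2) +
      ((q - q⁻¹) / 2) • (x (i + 1) * b - (-1 : ℂ) ^ i • (b * x (i + 1))) := by
  induction i using Nat.twoStepInduction with
  | zero => exact x_comm_cartan_of_le_one h hq h3 h6 0 zero_le_one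
  | one => exact x_comm_cartan_of_le_one h hq h3 h6 1 le_rfl
  | more i ih _ =>
    have hc := cartan_comm_b_sq h hq h3 h6 h4
    have hS := x_comm_b_sq h i
    have hS1 := x_comm_b_sq h (i + 1)
    have hS2 := x_comm_b_sq h (i + 2)
    generalize cartan q x y b = H at *
    simp only [show i + 2 + 1 = i + 1 + 2 by ring, pow_add, neg_one_sq, mul_one]
    linear_combination (norm := skip) ih * (b * b) - b * b * ih - hS * H + H * hS
      + (-1 : ℂ) ^ i • hS2 + ((q - q⁻¹) / 2) • (hS1 * b - (-1 : ℂ) ^ i • (b * hS1))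
      - x i * hc + hc * x i
    simp only [mul_add, add_mul, mul_sub, sub_mul, smul_mul_assoc, mul_smul_comm, mul_assoc]
    module

lemma y_comm_cartan {q : ℂ} {x y : ℕ → A} {b : A} (h : IsRootSystem q x y b) (hq : q ≠ 0)
    (h3 : q ^ 2 + q + 1 ≠ 0) (h6 : q ^ 2 - q + 1 ≠ 0) (h4 : q ^ 2 + 1 ≠ 0) (j : ℕ) :
    y j * cartan q x y b - cartan q x y b * y j = (-1 : ℂ) ^ j • y (j + 2) -
      ((q - q⁻¹) / 2) • (b * y (j + 1) + (-1 : ℂ) ^ j • (y (j + 1) * b)) := by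
  induction j using Nat.twoStepInduction with
  | zero => exact y_comm_cartan_of_le_one h hq h3 h6 0 zero_le_one
  | one => exact y_comm_cartan_of_le_one h hq h3 h6 1 le_rfl
  | more i ih _ =>
    have hc := cartan_comm_b_sq h hq h3 h6 h4
    have hS := y_comm_b_sq h i
    have hS1 := y_comm_b_sq h (i + 1)
    have hS2 := y_comm_b_sq h (i + 2)
    generalize cartan q x y b = H at *
    simp only [show i + 2 + 1 = i + 1 + 2 by ring, pow_add, neg_one_sq, mul_one]
    linear_combination (norm := skip) b * b * ih - ih * (b * b) - hS * H + H * hS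
      + (-1 : ℂ) ^ i • hS2 - ((q - q⁻¹) / 2) • (b * hS1 + (-1 : ℂ) ^ i • (hS1 * b))
      + y i * hc - hc * y i
    simp only [mul_add, add_mul, mul_sub, sub_mul, smul_mul_assoc, mul_smul_comm, mul_assoc]
    module

lemma Z_comm_cartan {q : ℂ} {x y : ℕ → A} {b : A} (h : IsRootSystem q x y b) (hq : q ≠ 0)
    (h3 : q ^ 2 + q + 1 ≠ 0) (h6 : q ^ 2 - q + 1 ≠ 0) (h4 : q ^ 2 + 1 ≠ 0) (i j : ℕ) :
    Z q x y i j * cartan q x y b - cartan q x y b * Z q x y i j =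
      (-1 : ℂ) ^ i • Z q x y (i + 2) j + (-1 : ℂ) ^ j • Z q x y i (j + 2) -
        ((q - q⁻¹) / 2) • ((-1 : ℂ) ^ j • ((Z q x y (i + 1) j + Z q x y i (j + 1)) * b) +
          (-1 : ℂ) ^ i • (b * (Z q x y (i + 1) j + Z q x y i (j + 1)))) :=
  Z_comm_of_comm h _ _ i j (x_comm_cartan h hq h3 h6 h4 i) (y_comm_cartan h hq h3 h6 h4 j)

/-- The relations between the even imaginary root vectors that come from the commutation of real
root vectors: `lam k` stands for `L_{2k+1}`, `Lam k` for `L'_{2k+3}`, `ell k` for `L̃_{2k}`. -/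
structure IsImaginaryTower (θ u : ℂ) (b H : A) (ell : ℤ → A) (lam Lam : ℕ → A) : Prop where
  ell_one : ell 1 = H + u • (b * b)
  ell_zero : ell 0 = θ⁻¹ • 1
  ell_neg : ∀ n < 0, ell n = 0
  cartan_comm : ⁅H, b * b⁆ = 0
  lam_zero : lam 0 = b
  lam_cartan : ∀ k : ℕ, ⁅lam k, H⁆ =
    (2 : ℂ) • lam (k + 1) + ⁅lam k, b * b⁆ - θ • (b * ell (k + 1) + ell (k + 1) * b)
  Lam_cartan : ∀ k : ℕ, ⁅Lam k, H⁆ =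
    -((2 : ℂ) • Lam (k + 1)) - ⁅Lam k, b * b⁆ + θ • (b * ell (k + 2) + ell (k + 2) * b)
      + (θ / 2) • (⁅ell (k + 1), b * b⁆ * b + b * ⁅ell (k + 1), b * b⁆)
      + (θ / 4) • (⁅lam k * b + b * lam k, b * b⁆ * b + b * ⁅lam k * b + b * lam k, b * b⁆)
  Lam_sub_lam : ∀ k : ℕ, Lam k - lam (k + 1) = ⁅ell (k + 1), b⁆ + (2 : ℂ)⁻¹ • ⁅lam k, b * b⁆
  ell_cartan : ∀ k : ℕ, (2 : ℂ) • ⁅ell (k + 1), H⁆ =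
    ⁅lam k, b * b⁆ * b + b * ⁅lam k, b * b⁆ - (θ / 2) • ⁅⁅lam k, b * b⁆, b⁆
  jordan_cartan : ∀ k : ℕ, ⁅lam k * b + b * lam k, H⁆ =
    (2 : ℂ) • ⁅ell (k + 1), b * b⁆ + θ • ⁅lam (k + 1) + Lam k, b⁆ + (θ / 2) • ⁅⁅lam k, b * b⁆, b⁆

lemma IsRootSystem.isImaginaryTower {q : ℂ} {x y : ℕ → A} {b : A} (h : IsRootSystem q x y b)
    (hq : q ≠ 0) (h3 : q ^ 2 + q + 1 ≠ 0) (h6 : q ^ 2 - q + 1 ≠ 0) (h4 : q ^ 2 + 1 ≠ 0) :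
    IsImaginaryTower (q - q⁻¹) ((q + q⁻¹) / 2) b (cartan q x y b) (ell q x y)
      (fun k => Z q x y 0 (2 * k)) (fun k => Z q x y 1 (2 * k + 1)) where
  ell_one := by rw [cartan]; abel
  ell_zero := rfl
  ell_neg
    | .negSucc _, _ => rfl
  cartan_comm := by rw [Ring.lie_def, cartan_comm_b_sq h hq h3 h6 h4, sub_self]
  lam_zero := Z_zero_zero h
  lam_cartan k := by
    have hd := Z_comm_cartan h hq h3 h6 h4 0 (2 * k)
    have hS := Z_comm_b_sq h 0 (2 * k)
    have he := ell_succ q x y k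
    simp only [pow_mul, pow_zero, neg_one_sq, one_pow, one_smul, zero_add, mul_add,
      mul_one] at hd hS ⊢
    simp only [Ring.lie_def, he]
    linear_combination (norm := skip) hd - hS
    simp only [mul_add, add_mul, smul_mul_assoc, mul_smul_comm, mul_assoc]
    module
  Lam_cartan k := by
    have hd := Z_comm_cartan h hq h3 h6 h4 1 (2 * k + 1)
    have hS := Z_comm_b_sq h 1 (2 * k + 1)
    have hS' := Z_comm_b_sq h 0 (2 * k + 1)
    have ho := Z_zero_odd h k
    have he := ell_succ q x y (k + 1)
    have e : (k : ℤ) + 2 = (k + 1 : ℕ) + 1 := by push_cast; ring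
    simp only [pow_mul, pow_add, pow_one, neg_one_sq, one_pow, one_mul, one_smul, neg_smul,
      zero_add, mul_add, mul_one, add_assoc, Nat.reduceAdd] at hd hS hS' ho he ⊢
    simp only [Ring.lie_def, e, he]
    rw [ho] at hS'
    linear_combination (norm := skip) hd + hS
      - ((q - q⁻¹) / 2) • (hS' * b + b * hS')
    simp only [mul_add, add_mul, mul_sub, sub_mul, smul_mul_assoc, mul_smul_comm, mul_assoc]
    module
  Lam_sub_lam k := by
    have hT := Z_comm_b h 0 (2 * k + 1)
    have ho := Z_zero_odd h k
    simp only [pow_mul, pow_add, neg_one_sq, one_pow, one_smul, zero_add, mul_add, mul_one,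
      add_assoc, Nat.reduceAdd] at hT ho ⊢
    rw [ho] at hT
    simp only [Ring.lie_def]
    linear_combination (norm := skip) -hT
    simp only [mul_add, add_mul, smul_mul_assoc, mul_smul_comm, mul_assoc]
    module
  ell_cartan k := by
    have hd := Z_comm_cartan h hq h3 h6 h4 0 (2 * k + 1)
    have hd' := Z_comm_cartan h hq h3 h6 h4 1 (2 * k)
    have hS := Z_comm_b_sq h 0 (2 * k + 1)
    have hS' := Z_comm_b_sq h 1 (2 * k)
    have hS2 := Z_comm_b_sq h 0 (2 * k)
    have ho := Z_zero_odd h k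
    have ho' := Z_one_even h k
    simp only [pow_mul, pow_add, pow_zero, pow_one, neg_one_sq, one_pow, one_smul, neg_smul,
      zero_add, mul_add, mul_one, add_assoc, Nat.reduceAdd, mul_neg] at hd hd' hS hS' hS2 ho ho' ⊢
    rw [ho] at hS hd
    rw [ho'] at hS' hd'
    simp only [Ring.lie_def]
    linear_combination (norm := skip) hd + hd' - hS + hS'
      + ((q - q⁻¹) / 2) • (hS2 * b - b * hS2)
    simp only [mul_add, add_mul, mul_sub, sub_mul, smul_mul_assoc, mul_smul_comm, mul_assoc]
    module
  jordan_cartan k := by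
    have hd := Z_comm_cartan h hq h3 h6 h4 0 (2 * k + 1)
    have hd' := Z_comm_cartan h hq h3 h6 h4 1 (2 * k)
    have hS := Z_comm_b_sq h 0 (2 * k + 1)
    have hS' := Z_comm_b_sq h 1 (2 * k)
    have hS2 := Z_comm_b_sq h 0 (2 * k)
    have ho := Z_zero_odd h k
    have ho' := Z_one_even h k
    simp only [pow_mul, pow_add, pow_zero, pow_one, neg_one_sq, one_pow, one_smul, neg_smul,
      zero_add, mul_add, mul_one, add_assoc, Nat.reduceAdd, mul_neg] at hd hd' hS hS' hS2 ho ho' ⊢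
    rw [ho] at hS hd
    rw [ho'] at hS' hd'
    simp only [Ring.lie_def]
    linear_combination (norm := skip) hd - hd' - hS - hS'
      - ((q - q⁻¹) / 2) • (hS2 * b - b * hS2)
    simp only [mul_add, add_mul, mul_sub, sub_mul, smul_mul_assoc, mul_smul_comm, mul_assoc]
    module

lemma lie_sq_recursion_aux (θ : ℂ) {L0 L1 L2 L3 L4 a b c d : A}
    (h0 : ⁅L0, a⁆ = (θ / 2) • (b * L1 + L1 * b) + (4 : ℂ)⁻¹ • ⁅L2, c⁆)
    (h1 : ⁅L1, a⁆ = (θ / 2) • (b * L2 + L2 * b) + (4 : ℂ)⁻¹ • ⁅L3, c⁆)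
    (h2 : ⁅L2, a⁆ = (θ / 2) • (b * L3 + L3 * b) + (4 : ℂ)⁻¹ • ⁅L4, c⁆)
    (hb : b = ⁅d, a⁆) (hc : c = ⁅d, b⁆) :
    ⁅L0, a * a⁆ = -((θ ^ 2 + 2) / 4) • ⁅L2, b * b⁆ - (16 : ℂ)⁻¹ • ⁅L4, c * c⁆
      + (θ / 2) • ((a * b + b * a) * L1 + L1 * (a * b + b * a))
      + (4 : ℂ)⁻¹ • ⁅L2, ⁅d, a * b + b * a⁆⁆
      - (θ / 8) • ((b * c + c * b) * L3 + L3 * (b * c + c * b)) := by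
  have hD : ⁅d, a * b + b * a⁆ = c * a + a * c + (2 : ℂ) • (b * b) := by
    simp only [Ring.lie_def] at hb hc ⊢
    linear_combination (norm := skip) -hb * b - b * hb - hc * a - a * hc
    simp only [mul_add, add_mul, mul_sub, sub_mul, mul_assoc]
    module
  rw [hD]
  simp only [Ring.lie_def] at *
  clear hb hc hD
  linear_combination (norm := skip) h0 * a + a * h0 + (θ / 2) • (b * h1 - h1 * b)
    - (4 : ℂ)⁻¹ • (c * h2 + h2 * c)
  simp only [mul_add, add_mul, mul_sub, sub_mul, smul_mul_assoc, mul_smul_comm, mul_assoc]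
  module

/-- A family `ell` (extended by zero to negative indices) whose commutators with `M 0` are given
up to index `k` by the three-term formula. -/
structure IsImaginaryChain (θ : ℂ) (ell : ℤ → A) (M : ℕ → A) (k : ℤ) : Prop where
  ne_zero : θ ≠ 0
  M_succ : ∀ i, M (i + 1) = ⁅ell 1, M i⁆
  ell_zero : ell 0 = θ⁻¹ • 1
  ell_neg : ∀ n < 0, ell n = 0
  ell_comm : ∀ J < k, ⁅ell 1, ell J⁆ = 0
  target : ∀ J ≤ k, ⁅ell J, M 0⁆ =
    (θ / 2) • (M 1 * ell (J - 1) + ell (J - 1) * M 1) + (4 : ℂ)⁻¹ • ⁅ell (J - 2), M 2⁆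
  jordan : ∀ i : ℕ, 2 * (i : ℤ) + 1 < k → M i * M (i + 1) + M (i + 1) * M i = 0

namespace IsImaginaryChain

variable {θ : ℂ} {ell : ℤ → A} {M : ℕ → A} {k : ℤ}

lemma lie_M_of_lt (h : IsImaginaryChain θ ell M k) (i : ℕ) (J : ℤ) (hJ : J < k) : ⁅ell J, M i⁆ =
    (θ / 2) • (M (i + 1) * ell (J - 1) + ell (J - 1) * M (i + 1))
      + (4 : ℂ)⁻¹ • ⁅ell (J - 2), M (i + 2)⁆ := by
  induction i with
  | zero => exact h.target J hJ.le
  | succ i ih =>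
    have c0 := h.ell_comm J hJ
    have c1 := h.ell_comm (J - 1) (by omega)
    have c2 := h.ell_comm (J - 2) (by omega)
    rw [h.M_succ i, h.M_succ (i + 1), h.M_succ (i + 2)]
    generalize ell 1 = d at *
    simp only [Ring.lie_def] at *
    linear_combination (norm := skip) d * ih - ih * d + M i * c0 - c0 * M i
      + (θ / 2) • (M (i + 1) * c1 + c1 * M (i + 1)) + (4 : ℂ)⁻¹ • (c2 * M (i + 2) - M (i + 2) * c2)
    simp only [mul_add, add_mul, mul_sub, sub_mul, smul_mul_assoc, mul_smul_comm, mul_assoc,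
      mul_zero, zero_mul]
    module

lemma lie_M (h : IsImaginaryChain θ ell M k) (i : ℕ) : ⁅ell (k - 2 * i), M i⁆ =
    (θ / 2) • (M (i + 1) * ell (k - 2 * i - 1) + ell (k - 2 * i - 1) * M (i + 1))
      + (4 : ℂ)⁻¹ • ⁅ell (k - 2 * i - 2), M (i + 2)⁆ := by
  rcases Nat.eq_zero_or_pos i with rfl | hi
  · simpa using h.target k le_rfl
  · exact h.lie_M_of_lt i _ (by omega)

lemma jordan_term (h : IsImaginaryChain θ ell M k) (i : ℕ) :
    (θ / 2) • ((M i * M (i + 1) + M (i + 1) * M i) * ell (k - 2 * i - 1)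
      + ell (k - 2 * i - 1) * (M i * M (i + 1) + M (i + 1) * M i)) =
    if 2 * (i : ℤ) + 1 = k then M i * M (i + 1) + M (i + 1) * M i else 0 := by
  have hθ := h.ne_zero
  split_ifs with hk
  · rw [show k - 2 * i - 1 = 0 by omega, h.ell_zero]
    simp only [smul_mul_assoc, mul_smul_comm, mul_one, one_mul]
    match_scalars <;> field_simp <;> norm_num
  · rcases lt_or_gt_of_ne hk with hk | hk
    · simp [h.jordan i hk]
    · simp [h.ell_neg (k - 2 * i - 1) (by omega)]

lemma lie_jordan_term (h : IsImaginaryChain θ ell M k) (i : ℕ) :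
    ⁅ell (k - 2 * i - 2), ⁅ell 1, M i * M (i + 1) + M (i + 1) * M i⁆⁆ = 0 := by
  rcases lt_or_ge (2 * (i : ℤ) + 1) k with hk | hk
  · simp [h.jordan i hk, Ring.lie_def]
  · simp [h.ell_neg (k - 2 * i - 2) (by omega), Ring.lie_def]

lemma lie_sq_recursion (h : IsImaginaryChain θ ell M k) (i : ℕ) :
    ⁅ell (k - 2 * i), M i * M i⁆ =
      -((θ ^ 2 + 2) / 4) • ⁅ell (k - 2 * (i + 1 : ℕ)), M (i + 1) * M (i + 1)⁆
      - (16 : ℂ)⁻¹ • ⁅ell (k - 2 * (i + 2 : ℕ)), M (i + 2) * M (i + 2)⁆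
      + (if 2 * (i : ℤ) + 1 = k then M i * M (i + 1) + M (i + 1) * M i else 0)
      - (4 : ℂ)⁻¹ • (if 2 * ((i + 1 : ℕ) : ℤ) + 1 = k then
          M (i + 1) * M (i + 2) + M (i + 2) * M (i + 1) else 0) := by
  have c1 := h.lie_M_of_lt i (k - 2 * i - 1) (by omega)
  have c2 := h.lie_M_of_lt i (k - 2 * i - 2) (by omega)
  have j1 := h.jordan_term (i + 1)
  have e1 : k - 2 * (i : ℤ) - 2 = k - 2 * (i + 1 : ℕ) := by push_cast; ring
  have e2 : k - 2 * (i : ℤ) - 2 - 2 = k - 2 * (i + 2 : ℕ) := by push_cast; ring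
  rw [show k - 2 * (i : ℤ) - 1 - 1 = k - 2 * i - 2 by ring,
    show k - 2 * (i : ℤ) - 1 - 2 = k - 2 * i - 2 - 1 by ring] at c1
  rw [← e1] at j1
  rw [lie_sq_recursion_aux θ (h.lie_M i) c1 c2 (h.M_succ i) (h.M_succ (i + 1)),
    h.lie_jordan_term, h.jordan_term, ← j1, ← e1, ← e2]
  module

lemma lie_sq_eq_zero_of_neg (h : IsImaginaryChain θ ell M k) (i : ℕ) (hi : k ≤ 2 * i) :
    ⁅ell (k - 2 * i), M i * M i⁆ = 0 := by
  rcases hi.eq_or_lt with rfl | hi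
  · simp [h.ell_zero, Ring.lie_def]
  · simp [h.ell_neg (k - 2 * i) (by omega), Ring.lie_def]

lemma lie_sq_eq_zero_of_even (h : IsImaginaryChain θ ell M k) (hk : Even k) (d i : ℕ)
    (hd : k ≤ 2 * (i + d)) : ⁅ell (k - 2 * i), M i * M i⁆ = 0 := by
  induction d using Nat.strong_induction_on generalizing i with
  | _ d ih =>
    rcases Nat.eq_zero_or_pos d with rfl | hd0
    · exact h.lie_sq_eq_zero_of_neg i (by simpa using hd)
    · obtain ⟨t, rfl⟩ := hk
      rw [h.lie_sq_recursion, ih (d - 1) (by omega) (i + 1) (by omega),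
        ih (d - 1) (by omega) (i + 2) (by omega), if_neg (by omega), if_neg (by omega)]
      simp

/-- The coefficients `θ⁻¹(q^{2r+1} - q^{-2r-1})`. -/
def oddQuantum (q : ℂ) (r : ℕ) : ℂ := (q - q⁻¹)⁻¹ * (q ^ (2 * r + 1) - q⁻¹ ^ (2 * r + 1))

lemma lie_sq_of_odd {q : ℂ} (hq : q ≠ 0) (h : IsImaginaryChain (q - q⁻¹) ell M k) (I : ℕ)
    (hk : k = 2 * I + 1) (r i : ℕ) (hr : i + r = I) : ⁅ell (k - 2 * i), M i * M i⁆ =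
      ((-4 : ℂ)⁻¹ ^ r * oddQuantum q r) • (M I * M (I + 1) + M (I + 1) * M I) := by
  have hθ := h.ne_zero
  induction r using Nat.twoStepInduction generalizing i with
  | zero =>
    obtain rfl : i = I := hr
    rw [h.lie_sq_recursion, h.lie_sq_eq_zero_of_neg (i + 1) (by omega),
      h.lie_sq_eq_zero_of_neg (i + 2) (by omega), if_pos (by omega), if_neg (by omega)]
    simp [oddQuantum, hθ]
  | one =>
    subst hr
    have h0 := h.lie_sq_recursion (i + 1)
    rw [h.lie_sq_eq_zero_of_neg (i + 1 + 1) (by omega),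
      h.lie_sq_eq_zero_of_neg (i + 1 + 2) (by omega), if_pos (by omega), if_neg (by omega)] at h0
    rw [h.lie_sq_recursion, h0, h.lie_sq_eq_zero_of_neg (i + 2) (by omega), if_neg (by omega),
      if_pos (by omega)]
    simp only [smul_zero, sub_zero, zero_add, add_zero, ← sub_smul]
    congr 1
    have hθ' : q ^ 2 - 1 ≠ 0 := by
      contrapose! hθ
      field_simp
      linear_combination hθ
    simp only [oddQuantum, inv_pow]
    field_simp
    ring
  | more r ih0 ih1 =>
    rw [h.lie_sq_recursion, ih0 (i + 2) (by omega), ih1 (i + 1) (by omega), if_neg (by omega),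
      if_neg (by omega)]
    simp only [smul_zero, sub_zero, add_zero, smul_smul, ← sub_smul]
    congr 1
    simp only [oddQuantum, inv_pow, pow_succ, mul_add]
    field_simp
    ring

lemma lie_sq_eq_zero {q : ℂ} (hq : q ≠ 0) (hq' : ∀ n : ℕ, n ≠ 0 → q ^ n ≠ 1)
    (h : IsImaginaryChain (q - q⁻¹) ell M k) (hk : 2 ≤ k)
    (h1 : (6 + 2 * (q - q⁻¹) ^ 2) • ⁅ell k, M 0 * M 0⁆ = -((2 : ℂ)⁻¹ • ⁅ell (k - 2), M 1 * M 1⁆)) :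
    ⁅ell k, M 0 * M 0⁆ = 0 ∧
      ∀ i : ℕ, 2 * (i : ℤ) + 1 = k → M i * M (i + 1) + M (i + 1) * M i = 0 := by
  rcases Int.even_or_odd k with he | ⟨I, hI⟩
  · refine ⟨?_, fun i hi => absurd he (by rw [← hi]; simp)⟩
    simpa using h.lie_sq_eq_zero_of_even he k.toNat 0 (by simp; omega)
  · obtain ⟨J, rfl⟩ : ∃ J : ℕ, I = J + 1 := ⟨(I - 1).toNat, by omega⟩
    have w0 := h.lie_sq_of_odd hq (J + 1) (by push_cast; exact hI) (J + 1) 0 (by omega)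
    have w1 := h.lie_sq_of_odd hq (J + 1) (by push_cast; exact hI) J 1 (by omega)
    simp only [Nat.cast_zero, Nat.cast_one, mul_zero, mul_one, sub_zero] at w0 w1
    have hm : M (J + 1) * M (J + 1 + 1) + M (J + 1 + 1) * M (J + 1) = 0 := by
      rw [w0, w1, smul_smul, smul_smul, ← neg_smul, ← sub_eq_zero, ← sub_smul] at h1
      refine (smul_eq_zero.1 h1).resolve_left ?_
      have e : (6 + 2 * (q - q⁻¹) ^ 2) * ((-4 : ℂ)⁻¹ ^ (J + 1) * oddQuantum q (J + 1)) -
          -(2⁻¹ * ((-4 : ℂ)⁻¹ ^ J * oddQuantum q J)) =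
          -((-4 : ℂ)⁻¹ ^ J * (q - q⁻¹)⁻¹ * (q ^ 2 + 1) * (q ^ (4 * J + 8) - 1)
            / (2 * q ^ (2 * J + 5))) := by
        have hθ' : q ^ 2 - 1 ≠ 0 := sub_ne_zero.2 (hq' 2 two_ne_zero)
        simp only [oddQuantum, inv_pow, pow_succ, mul_add]
        field_simp
        ring
      rw [e]
      have h4 : q ^ 2 + 1 ≠ 0 := fun h0 =>
        hq' 4 four_ne_zero (by linear_combination (q ^ 2 - 1) * h0)
      have h8 : q ^ (4 * J + 8) - 1 ≠ 0 := sub_ne_zero.2 (hq' _ (by omega))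
      exact neg_ne_zero.2 (div_ne_zero (mul_ne_zero (mul_ne_zero (mul_ne_zero
        (pow_ne_zero _ (by norm_num)) (inv_ne_zero h.ne_zero)) h4) h8)
        (mul_ne_zero two_ne_zero (pow_ne_zero _ hq)))
    refine ⟨by rw [w0, hm, smul_zero], fun i hi => ?_⟩
    obtain rfl : i = J + 1 := by omega
    exact hm

end IsImaginaryChain

section aux

variable {θ : ℂ} {b H M1 M2 e0 e1 e2 lam1 lam2 Lam0 Lam1 : A}

lemma sum_formula_aux
    (hA : ⁅lam1, H⁆ = (2 : ℂ) • lam2 - θ • (b * e2 + e2 * b))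
    (hB : ⁅Lam0, H⁆ = -((2 : ℂ) • Lam1) + θ • (b * e2 + e2 * b))
    (hC : Lam0 - lam1 = ⁅e1, b⁆) (he1 : ⁅e1, H⁆ = 0) (hb : ⁅b, H⁆ = -M1) :
    lam2 + Lam1 = θ • (b * e2 + e2 * b) + (2 : ℂ)⁻¹ • ⁅e1, M1⁆ := by
  simp only [Ring.lie_def] at *
  linear_combination (norm := skip) (2 : ℂ)⁻¹ • (hB - hA - (hC * H - H * hC)
    - (e1 * hb - hb * e1) - (he1 * b - b * he1))
  simp only [mul_sub, sub_mul, mul_assoc,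
    mul_zero, zero_mul, neg_mul, mul_neg]
  module

lemma target_aux
    (hA : ⁅lam1, H⁆ = (2 : ℂ) • lam2 - θ • (b * e2 + e2 * b))
    (hB : ⁅Lam0, H⁆ = -((2 : ℂ) • Lam1) + θ • (b * e2 + e2 * b))
    (hC : Lam1 - lam2 = ⁅e2, b⁆) (he1 : ⁅e1, H⁆ = 0) (he0 : ⁅e0, H⁆ = 0)
    (hb : ⁅b, H⁆ = -M1) (hM : ⁅M1, H⁆ = -M2)
    (hN : lam1 + Lam0 = θ • (b * e1 + e1 * b) + (2 : ℂ)⁻¹ • ⁅e0, M1⁆) :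
    ⁅e2, b⁆ = (θ / 2) • (M1 * e1 + e1 * M1) + (4 : ℂ)⁻¹ • ⁅e0, M2⁆ := by
  simp only [Ring.lie_def] at *
  linear_combination (norm := skip) (2 : ℂ)⁻¹ • (hA + hB - (hN * H - H * hN)) - hC
    - (θ / 2) • (hb * e1 + e1 * hb + b * he1 + he1 * b)
    - (4 : ℂ)⁻¹ • (e0 * hM - hM * e0 + he0 * M1 - M1 * he0)
  simp only [mul_add, add_mul, mul_sub, sub_mul, smul_mul_assoc, mul_smul_comm, mul_assoc,
    mul_zero, zero_mul, neg_mul, mul_neg]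
  module

lemma lie_sq_relation_aux
    (hA : ⁅lam1, H⁆ = (2 : ℂ) • lam2 - θ • (b * e2 + e2 * b))
    (hK : ⁅lam1 * b + b * lam1, H⁆ = (2 : ℂ) • ⁅e2, b * b⁆ + θ • ⁅lam2 + Lam1, b⁆)
    (hC0 : Lam0 - lam1 = ⁅e1, b⁆) (hC1 : Lam1 - lam2 = ⁅e2, b⁆)
    (hb : ⁅b, H⁆ = -M1) (hm : b * M1 + M1 * b = 0)
    (hN0 : lam1 + Lam0 = θ • (b * e1 + e1 * b) + (2 : ℂ)⁻¹ • ⁅e0, M1⁆)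
    (hN1 : lam2 + Lam1 = θ • (b * e2 + e2 * b) + (2 : ℂ)⁻¹ • ⁅e1, M1⁆) :
    (6 + 2 * θ ^ 2) • ⁅e2, b * b⁆ = -((2 : ℂ)⁻¹ • ⁅e0, M1 * M1⁆) := by
  simp only [Ring.lie_def] at *
  linear_combination (norm := skip) (-2 : ℂ) • (hK - hA * b - b * hA - lam1 * hb - hb * lam1
      - (hN1 - hC1) * b - b * (hN1 - hC1) + θ • (hN1 * b - b * hN1))
    - (hN0 - hC0) * M1 - M1 * (hN0 - hC0) + (e1 * hm - hm * e1) - θ • (e1 * hm + hm * e1)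
  simp only [mul_add, add_mul, mul_sub, sub_mul, smul_mul_assoc, mul_smul_comm, mul_assoc,
    mul_zero, zero_mul, neg_mul, mul_neg]
  module

end aux

/-- The relations proved by simultaneous induction on `k`. -/
structure TowerRelationsAt (θ : ℂ) (b H : A) (ell : ℤ → A) (lam Lam : ℕ → A) (M : ℕ → A)
    (k : ℕ) : Prop where
  ell_b_sq : ⁅ell k, b * b⁆ = 0
  lam_b_sq : ⁅lam k, b * b⁆ = 0
  ell_cartan : ⁅ell k, H⁆ = 0
  target : ⁅ell k, b⁆ =
    (θ / 2) • (M 1 * ell ((k : ℤ) - 1) + ell ((k : ℤ) - 1) * M 1)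
      + (4 : ℂ)⁻¹ • ⁅ell ((k : ℤ) - 2), M 2⁆
  lam_add_Lam : ∀ n, k = n + 1 → lam (n + 1) + Lam n =
    θ • (b * ell ((n : ℤ) + 1) + ell ((n : ℤ) + 1) * b) + (2 : ℂ)⁻¹ • ⁅ell n, M 1⁆
  jordan : ∀ i : ℕ, 2 * i + 1 = k → M i * M (i + 1) + M (i + 1) * M i = 0

namespace IsImaginaryTower

section

variable {θ u : ℂ} {b H : A} {ell : ℤ → A} {lam Lam : ℕ → A} {M : ℕ → A}

lemma ell_one_lie_b_sq (h : IsImaginaryTower θ u b H ell lam Lam) : ⁅ell 1, b * b⁆ = 0 := by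
  have := h.cartan_comm
  rw [h.ell_one]
  simp only [Ring.lie_def] at *
  linear_combination (norm := skip) this
  simp only [mul_add, add_mul, smul_mul_assoc, mul_smul_comm, mul_assoc]
  module

lemma jordan_zero (h : IsImaginaryTower θ u b H ell lam Lam) (hM0 : M 0 = b)
    (hM : ∀ i, M (i + 1) = ⁅ell 1, M i⁆) : b * M 1 + M 1 * b = 0 := by
  rw [← h.ell_one_lie_b_sq, hM 0, hM0]
  simp only [Ring.lie_def]
  noncomm_ring

lemma b_cartan (h : IsImaginaryTower θ u b H ell lam Lam) (hM0 : M 0 = b)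
    (hM : ∀ i, M (i + 1) = ⁅ell 1, M i⁆) : ⁅b, H⁆ = -M 1 := by
  rw [hM 0, hM0, h.ell_one]
  simp only [Ring.lie_def, mul_add, add_mul, smul_mul_assoc, mul_smul_comm, mul_assoc]
  module

lemma M_one_cartan (h : IsImaginaryTower θ u b H ell lam Lam) (hM0 : M 0 = b)
    (hM : ∀ i, M (i + 1) = ⁅ell 1, M i⁆) : ⁅M 1, H⁆ = -M 2 := by
  have hm := h.jordan_zero hM0 hM
  rw [hM 1, h.ell_one]
  generalize M 1 = m at *
  simp only [Ring.lie_def] at *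
  linear_combination (norm := skip) u • (b * hm - hm * b)
  simp only [mul_add, add_mul, smul_mul_assoc, mul_smul_comm, mul_assoc, zero_mul, mul_zero]
  module

lemma lie_ell_one (h : IsImaginaryTower θ u b H ell lam Lam) {e : A} (hS : ⁅e, b * b⁆ = 0)
    (hH : ⁅e, H⁆ = 0) : ⁅ell 1, e⁆ = 0 := by
  rw [h.ell_one]
  simp only [Ring.lie_def] at *
  linear_combination (norm := skip) -hH - u • hS
  simp only [mul_add, add_mul, smul_mul_assoc, mul_smul_comm, mul_assoc]
  module

lemma lam_succ_b_sq (h : IsImaginaryTower θ u b H ell lam Lam) (k : ℕ) (hl : ⁅lam k, b * b⁆ = 0)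
    (he : ⁅ell ((k : ℤ) + 1), b * b⁆ = 0) : ⁅lam (k + 1), b * b⁆ = 0 := by
  have hA := h.lam_cartan k
  have hH := h.cartan_comm
  refine smul_right_injective A (two_ne_zero (α := ℂ)) ?_
  simp only [Ring.lie_def] at *
  linear_combination (norm := skip) b * b * hA - hA * (b * b) + hl * H - H * hl
    + lam k * hH - hH * lam k - hl * (b * b) + b * b * hl + θ • (b * he + he * b)
  simp only [mul_add, add_mul, mul_sub, sub_mul, smul_mul_assoc, mul_smul_comm, mul_assoc,
    zero_mul, mul_zero]
  module

lemma relationsAt_zero (h : IsImaginaryTower θ u b H ell lam Lam) :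
    TowerRelationsAt θ b H ell lam Lam M 0 where
  ell_b_sq := by simp [h.ell_zero, Ring.lie_def]
  lam_b_sq := by simp [h.lam_zero, Ring.lie_def, mul_assoc]
  ell_cartan := by simp [h.ell_zero, Ring.lie_def]
  target := by
    rw [h.ell_neg _ (by norm_num : ((0 : ℕ) : ℤ) - 1 < 0),
      h.ell_neg _ (by norm_num : ((0 : ℕ) : ℤ) - 2 < 0)]
    simp [h.ell_zero, Ring.lie_def]
  lam_add_Lam n hn := by omega
  jordan i hi := by omega

lemma relationsAt_one (h : IsImaginaryTower θ u b H ell lam Lam) (hθ : θ ≠ 0) (hM0 : M 0 = b)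
    (hM : ∀ i, M (i + 1) = ⁅ell 1, M i⁆) : TowerRelationsAt θ b H ell lam Lam M 1 where
  ell_b_sq := h.ell_one_lie_b_sq
  lam_b_sq := h.lam_succ_b_sq 0 (h.relationsAt_zero (M := M)).lam_b_sq h.ell_one_lie_b_sq
  ell_cartan := by
    have := h.cartan_comm
    rw [Nat.cast_one, h.ell_one]
    simp only [Ring.lie_def] at *
    linear_combination (norm := skip) (-u) • this
    simp only [mul_add, add_mul, smul_mul_assoc, mul_smul_comm, mul_assoc]
    module
  target := by
    have := hM 0
    rw [hM0] at this
    simp only [Nat.cast_one, sub_self, h.ell_zero, h.ell_neg _ (by norm_num : (1 : ℤ) - 2 < 0),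
      ← this]
    simp only [Ring.lie_def, zero_mul, mul_zero, smul_mul_assoc, mul_smul_comm, mul_one, one_mul,
      sub_zero, smul_zero]
    match_scalars
    field_simp
    norm_num
  lam_add_Lam n hn := by
    obtain rfl : n = 0 := by omega
    have hA := h.lam_cartan 0
    have hC := h.Lam_sub_lam 0
    have hb := h.b_cartan hM0 hM
    have h1 := hM 0
    simp only [h.lam_zero, hM0, Nat.cast_zero, zero_add, h.ell_zero] at *
    generalize M 1 = m at *
    generalize ell 1 = e at *
    simp only [Ring.lie_def] at *
    linear_combination (norm := skip) hC - hA + hb - h1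
    simp only [smul_mul_assoc, mul_smul_comm, mul_assoc, mul_one, one_mul]
    module
  jordan i hi := by
    obtain rfl : i = 0 := by omega
    rw [hM0]
    exact h.jordan_zero hM0 hM

end

variable {q u : ℂ} {b H : A} {ell : ℤ → A} {lam Lam : ℕ → A} {M : ℕ → A}

lemma relationsAt_add_two (h : IsImaginaryTower (q - q⁻¹) u b H ell lam Lam) (hq : q ≠ 0)
    (hq' : ∀ n : ℕ, n ≠ 0 → q ^ n ≠ 1) (hθ : q - q⁻¹ ≠ 0) (hM0 : M 0 = b)
    (hM : ∀ i, M (i + 1) = ⁅ell 1, M i⁆) (n : ℕ)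
    (ih : ∀ j < n + 2, TowerRelationsAt (q - q⁻¹) b H ell lam Lam M j) :
    TowerRelationsAt (q - q⁻¹) b H ell lam Lam M (n + 2) := by
  have i0 := ih n (by omega)
  have i1 := ih (n + 1) (by omega)
  have hb := h.b_cartan hM0 hM
  have e12 : (n : ℤ) + 1 + 1 = n + 2 := by ring
  have hS0 := i0.lam_b_sq
  have hS1 := i1.lam_b_sq
  have hE1 := i1.ell_b_sq
  have hN0 := i1.lam_add_Lam n rfl
  have hA := h.lam_cartan (n + 1)
  have hC0 := h.Lam_sub_lam n
  have hC1 := h.Lam_sub_lam (n + 1)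
  have hK := h.jordan_cartan (n + 1)
  have hB := h.Lam_cartan n
  have he1 := i1.ell_cartan
  push_cast at hE1 hA hC0 hC1 hK hB he1
  rw [e12] at hA hC1 hK
  have hSL : ⁅Lam n, b * b⁆ = 0 := by
    rw [hS0] at hC0
    simp only [Ring.lie_def] at *
    linear_combination (norm := skip) hC0 * (b * b) - b * b * hC0 + hS1 + hE1 * b - b * hE1
    simp only [mul_add, add_mul, mul_sub, sub_mul, smul_mul_assoc, mul_smul_comm, mul_assoc,
      zero_mul, mul_zero]
    module
  have hSJ : ⁅lam n * b + b * lam n, b * b⁆ = 0 := by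
    simp only [Ring.lie_def] at *
    linear_combination (norm := skip) hS0 * b + b * hS0
    simp only [mul_add, add_mul, mul_sub, sub_mul, mul_assoc, zero_mul, mul_zero]
    module
  rw [hS0, smul_zero, add_zero] at hC0
  rw [hS1, smul_zero, add_zero] at hC1
  rw [hS1, add_zero] at hA
  rw [hSL, hE1, hSJ] at hB
  rw [hS1] at hK
  simp only [mul_zero, zero_mul, add_zero, smul_zero, sub_zero] at hB
  simp only [Ring.lie_def (0 : A), mul_zero, zero_mul, smul_zero, sub_zero, add_zero] at hK
  have hN1 := sum_formula_aux hA hB hC0 he1 hb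
  have htarget := target_aux hA hB hC1 he1 i0.ell_cartan hb (h.M_one_cartan hM0 hM) hN0
  have hrel := lie_sq_relation_aux hA hK hC0 hC1 hb (h.jordan_zero hM0 hM) hN0 hN1
  have i2 : (n : ℤ) + 2 - 2 = n := by ring
  have i3 : (n : ℤ) + 2 - 1 = n + 1 := by ring
  have hchain : IsImaginaryChain (q - q⁻¹) ell M ((n : ℤ) + 2) :=
    { ne_zero := hθ
      M_succ := hM
      ell_zero := h.ell_zero
      ell_neg := h.ell_neg
      ell_comm := fun J hJ => by
        rcases lt_or_ge J 0 with hJ0 | hJ0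
        · simp [h.ell_neg J hJ0, Ring.lie_def]
        · lift J to ℕ using hJ0
          have := ih J (by omega)
          exact h.lie_ell_one this.ell_b_sq this.ell_cartan
      target := fun J hJ => by
        rw [hM0]
        rcases lt_or_ge J 0 with hJ0 | hJ0
        · simp [h.ell_neg J hJ0, h.ell_neg (J - 1) (by omega), h.ell_neg (J - 2) (by omega),
            Ring.lie_def]
        · rcases hJ.eq_or_lt with rfl | hJ
          · rw [i2, i3]
            exact htarget
          · lift J to ℕ using hJ0
            exact (ih J (by omega)).target
      jordan := fun i hi => (ih (2 * i + 1) (by omega)).jordan i rfl }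
  obtain ⟨hE, hj⟩ := hchain.lie_sq_eq_zero hq hq' (by omega) (by rw [hM0, i2]; exact hrel)
  rw [hM0] at hE
  refine ⟨by exact_mod_cast hE, h.lam_succ_b_sq (n + 1) hS1 (by push_cast; rwa [e12]),
    ?_, ?_, ?_, ?_⟩
  · have := h.ell_cartan (n + 1)
    rw [hS1] at this
    push_cast at this ⊢
    rw [e12] at this
    simpa [Ring.lie_def (0 : A)] using this
  · push_cast
    rw [i2, i3]
    exact htarget
  · intro m hm
    obtain rfl : m = n + 1 := by omega
    push_cast
    rw [e12]
    exact hN1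
  · intro i hi
    exact hj i (by exact_mod_cast hi)

lemma relationsAt (h : IsImaginaryTower (q - q⁻¹) u b H ell lam Lam) (hq : q ≠ 0)
    (hq' : ∀ n : ℕ, n ≠ 0 → q ^ n ≠ 1) (hθ : q - q⁻¹ ≠ 0) (hM0 : M 0 = b)
    (hM : ∀ i, M (i + 1) = ⁅ell 1, M i⁆) (k : ℕ) :
    TowerRelationsAt (q - q⁻¹) b H ell lam Lam M k := by
  induction k using Nat.strong_induction_on with
  | _ k ih =>
    match k, ih with
    | 0, _ => exact h.relationsAt_zero
    | 1, _ => exact h.relationsAt_one hθ hM0 hM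
    | n + 2, ih => exact h.relationsAt_add_two hq hq' hθ hM0 hM n ih

end IsImaginaryTower

end

lemma isRootSystem (q : ℂ) :
    IsRootSystem q (fun i => X q (i + 1)) (fun j => Y q (j + 1)) (L1U q) where
  b_eq := rfl
  x_succ _ := rfl
  y_succ j := by
    simp only [Y, pow_succ]
    module
  serre_x := by
    have h : π q (serre1 q) = π q 0 := RingQuot.mkAlgHom_rel ℂ Rel.one
    simp only [serre1, X2F, L1F, map_sub, map_mul, map_smul, map_zero] at h
    simpa [X, L1U] using sub_eq_zero.1 h
  serre_y := by
    have h : π q (serre2 q) = π q 0 := RingQuot.mkAlgHom_rel ℂ Rel.two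
    simp only [serre2, Y2F, L1F, map_add, map_sub, map_mul, map_smul, map_zero] at h
    have hY : Y q 2 = L1U q * π q x2 + π q x2 * L1U q := by
      simp only [Y]
      module
    rw [zero_add, hY]
    exact sub_eq_zero.1 h

lemma Lt_two_mul (q : ℂ) (m : ℤ) :
    Lt q (2 * m) = ell q (fun i => X q (i + 1)) (fun j => Y q (j + 1)) m := by
  match m with
  | .ofNat 0 =>
    simp only [Lt, ell, L, L', θ, Int.ofNat_eq_natCast, Nat.cast_zero, mul_zero, le_refl, if_true,
      Int.toNat_zero]
    module
  | .ofNat (k + 1) =>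
    have e : (2 * Int.ofNat (k + 1)).toNat = 2 * k + 2 := by
      rw [Int.ofNat_eq_natCast]
      omega
    rw [Lt, if_pos (by simp; omega), e, ell]
    simp [L, L', Z]
  | .negSucc k =>
    rw [Lt, if_neg (by omega), ell]

lemma L_two (q : ℂ) : L q 2 =
    ell q (fun i => X q (i + 1)) (fun j => Y q (j + 1)) 1 + L1U q * L1U q := by
  have h := Z_zero_odd (isRootSystem q) 0
  simp only [mul_zero, Nat.cast_zero, zero_add, Z_zero_zero (isRootSystem q)] at h
  rw [show L q 2 = Z q (fun i => X q (i + 1)) (fun j => Y q (j + 1)) 0 1 by simp [L, Z], h]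
  module

end QAff

open QAff

/-- In `U = U_q(A(0,2)^{(4)})^+`, for every `n ≥ 1`:
`[L̃_{2n}, L₁] = (θ/2)M₃L̃_{2n-2} + (θ/2)L̃_{2n-2}M₃ + (1/4)[L̃_{2n-4}, M₅]`,
with `[L̃_{2n}, L₁] = L̃_{2n}L₁ - L₁L̃_{2n}` and `[L̃_{2n-4}, M₅] = L̃_{2n-4}M₅ - M₅L̃_{2n-4}`
plain commutators and the conventions `L̃₀ = θ⁻¹·1`, `L̃_m = 0` for `m < 0`. -/
theorem stmt10 (q : ℂ) (hq0 : q ≠ 0) (hq : NotRootOfUnity q) (n : ℕ) (hn : 1 ≤ n) :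
    Lt q (2*(n : ℤ)) * L q 1 - L q 1 * Lt q (2*(n : ℤ))
      = (θ q / 2) • (M q 1 * Lt q (2*(n : ℤ) - 2))
        + (θ q / 2) • (Lt q (2*(n : ℤ) - 2) * M q 1)
        + (4 : ℂ)⁻¹ • (Lt q (2*(n : ℤ) - 4) * M q 2 - M q 2 * Lt q (2*(n : ℤ) - 4)) := by
  have h2 : q ^ 2 ≠ 1 := hq 2 two_ne_zero
  have h3 : q ^ 2 + q + 1 ≠ 0 := fun h => hq 3 (by norm_num) (by linear_combination (q - 1) * h)
  have h4 : q ^ 2 + 1 ≠ 0 := fun h => hq 4 (by norm_num) (by linear_combination (q ^ 2 - 1) * h)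
  have h6 : q ^ 2 - q + 1 ≠ 0 := fun h =>
    hq 6 (by norm_num) (by linear_combination (q ^ 3 - 1) * (q + 1) * h)
  have hθ : q - q⁻¹ ≠ 0 := by
    contrapose! h2
    field_simp at h2
    linear_combination h2
  have tower := (isRootSystem q).isImaginaryTower hq0 h3 h6 h4
  set e := ell q (fun i => X q (i + 1)) (fun j => Y q (j + 1)) with he
  set M' : ℕ → U q := fun i => (fun m => ⁅e 1, m⁆)^[i] (L1U q) with hM'
  have hM (i : ℕ) : M' (i + 1) = ⁅e 1, M' i⁆ := Function.iterate_succ_apply' _ _ _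
  have hL1 : L q 1 = L1U q := rfl
  have hm := tower.jordan_zero rfl hM
  have hM1 : M q 1 = M' 1 := by
    rw [hM 0, M, M, L_two, hL1, show M' 0 = L1U q from rfl, ← he, Ring.lie_def]
    noncomm_ring
  have hM2 : M q 2 = M' 2 := by
    rw [hM 1, M, hM1, L_two, ← he, Ring.lie_def]
    linear_combination (norm := noncomm_ring) L1U q * hm - hm * L1U q
  rw [show 2 * (n : ℤ) - 2 = 2 * (n - 1) by ring, show 2 * (n : ℤ) - 4 = 2 * (n - 2) by ring,
    Lt_two_mul, Lt_two_mul, Lt_two_mul, hL1, hM1, hM2, ← smul_add]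
  exact (tower.relationsAt hq0 hq hθ rfl hM n).target
end
end
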